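/- arXiv:math/0701158 — 2 statements merged into one kernel-verified Lean document; each statement's English description precedes it below -/
import Mathlib

section
/- Let p ∈ [1,∞), and let (λ_n)_{n∈ℤ} and (α_n)_{n∈ℤ} be real sequences such that λ_n = π(n+1/2) + e_n(f) and α_n = 1 + e_n(g) for some f, g ∈ L_p(0,1). For N ∈ ℕ put S_N(s) := Σ_{n=−N}^{N} (α_n e^{−2λ_n sB} − e^{−π(2n+1) sB}) (matrix exponentials of sB). Then: if p > 1, the partial sums S_N converge in L_p((−1,1), M₂) as N → ∞; if p = 1, the Cesàro means (1/N) Σ_{k=1}^{N} S_k converge in L₁((−1,1), M₂) as N → ∞. -/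
open MeasureTheory Complex Filter Set
open scoped Matrix.Norms.L2Operator ENNReal

noncomputable section

abbrev M2 := Matrix (Fin 2) (Fin 2) ℂ

def Bmat : M2 := !![0, 1; -1, 0]

def Jmat : M2 := !![1, 0; 0, -1]

/-- `expB τ = e^{-τ B} = [[cos τ, -sin τ],[sin τ, cos τ]]`. -/
def expB (τ : ℂ) : M2 := !![Complex.cos τ, -Complex.sin τ; Complex.sin τ, Complex.cos τ]

/-- Lebesgue measure restricted to `(0,1)`. -/
def μ01 : Measure ℝ := volume.restrict (Set.Ioo 0 1)

/-- Lebesgue measure restricted to `(-1,1)`. -/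
def μ11 : Measure ℝ := volume.restrict (Set.Ioo (-1) 1)

/-- A Dirac-form potential `Q = [[q₁,q₂],[q₂,-q₁]]`. -/
def IsDiracForm (Q : ℝ → M2) : Prop :=
  ∃ q1 q2 : ℝ → ℂ, ∀ x, Q x = !![q1 x, q2 x; q2 x, -q1 x]

/-- A Dirac-form potential with real-valued entries. -/
def IsRealDiracForm (Q : ℝ → M2) : Prop :=
  ∃ q1 q2 : ℝ → ℝ, ∀ x, Q x = !![(q1 x : ℂ), (q2 x : ℂ); (q2 x : ℂ), -(q1 x : ℂ)]

/-- `U` is an absolutely continuous matrix solution of `B U' + Q U = λ U` a.e. on `(0,1)`. -/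
def IsMatSolution (Q : ℝ → M2) (l : ℂ) (U : ℝ → M2) : Prop :=
  ∃ U' : ℝ → M2, IntegrableOn U' (Set.Ioo 0 1) ∧
    (∀ x ∈ Set.Icc (0:ℝ) 1, U x = U 0 + ∫ t in (0:ℝ)..x, U' t) ∧
    (∀ᵐ x ∂μ01, Bmat * U' x + Q x * U x = l • U x)

/-- `u` is an absolutely continuous `ℂ²`-valued solution of `B u' + Q u = λ u` a.e. on `(0,1)`. -/
def IsVecSolution (Q : ℝ → M2) (l : ℂ) (u : ℝ → Fin 2 → ℂ) : Prop :=
  ∃ u' : ℝ → Fin 2 → ℂ, IntegrableOn u' (Set.Ioo 0 1) ∧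
    (∀ x ∈ Set.Icc (0:ℝ) 1, u x = u 0 + ∫ t in (0:ℝ)..x, u' t) ∧
    (∀ᵐ x ∂μ01, Bmat.mulVec (u' x) + (Q x).mulVec (u x) = l • u x)

/-- `λ` is an eigenvalue of the Dirac operator `A_j` (`j = 0` for `A₁`, `j = 1` for `A₂`):
there is a nonzero AC solution with `u₂(0) = 0` and `u_j(1) = 0`. -/
def IsEigenvalue (Q : ℝ → M2) (j : Fin 2) (l : ℝ) : Prop :=
  ∃ u : ℝ → Fin 2 → ℂ, IsVecSolution Q (l : ℂ) u ∧
    (∃ x ∈ Set.Icc (0:ℝ) 1, u x ≠ 0) ∧ u 0 1 = 0 ∧ u 1 j = 0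

/-- `c₀(·,λ) = (cos λx, sin λx)ᵗ`. -/
def c0 (l : ℂ) (x : ℝ) : Fin 2 → ℂ := ![Complex.cos (l * x), Complex.sin (l * x)]

/-- n-th Fourier coefficient `e_n(g) = ∫₀¹ e^{-2πinx} g(x) dx`. -/
def fc (g : ℝ → ℂ) (n : ℤ) : ℂ :=
  ∫ x in (0:ℝ)..1, Complex.exp (-2 * Real.pi * Complex.I * n * x) * g x

/-- The square of the `ℍ = L₂((0,1),ℂ²)` norm of `u`. -/
def hnormSq (u : ℝ → Fin 2 → ℂ) : ℝ :=
  ∫ x in Set.Ioo (0:ℝ) 1, (‖u x 0‖ ^ 2 + ‖u x 1‖ ^ 2)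

/-- The `ℂ²` inner product `⟨v,w⟩ = v₁ w̄₁ + v₂ w̄₂`. -/
def ip2 (v w : Fin 2 → ℂ) : ℂ := v 0 * star (w 0) + v 1 * star (w 1)

/-- The eigenvalue asymptotics `λ_n = π(n+1/2) + e_n(g)` for some `g ∈ L_p(0,1)`. -/
def LamAsymp (p : ℝ≥0∞) (lam : ℤ → ℝ) : Prop :=
  ∃ g : ℝ → ℂ, MemLp g p μ01 ∧
    ∀ n : ℤ, (lam n : ℂ) = Real.pi * (n + 1/2) + fc g n

/-- The eigenvalue asymptotics `μ_n = πn + e_n(g)` for some `g ∈ L_p(0,1)`. -/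
def MuAsymp (p : ℝ≥0∞) (mu : ℤ → ℝ) : Prop :=
  ∃ g : ℝ → ℂ, MemLp g p μ01 ∧
    ∀ n : ℤ, (mu n : ℂ) = Real.pi * n + fc g n

/-- The norming-constant asymptotics `α_n = 1 + e_n(g)` for some `g ∈ L_p(0,1)`. -/
def AlAsymp (p : ℝ≥0∞) (al : ℤ → ℝ) : Prop :=
  ∃ g : ℝ → ℂ, MemLp g p μ01 ∧ ∀ n : ℤ, (al n : ℂ) = 1 + fc g n

/-- Membership in the class `SD_p` of spectral data. -/
def MemSD (p : ℝ≥0∞) (lam mu : ℤ → ℝ) : Prop :=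
  (∀ n : ℤ, lam (n - 1) < mu n ∧ mu n < lam n) ∧ LamAsymp p lam ∧ MuAsymp p mu

/-- Membership in the kernel space `G_p(M₂)`: all slices lie in `L_p` and the slice maps are
continuous from `[0,1]` to `L_p((0,1),M₂)`. -/
def MemGp (p : ℝ≥0∞) (K : ℝ → ℝ → M2) : Prop :=
  (∀ x ∈ Set.Icc (0:ℝ) 1, MemLp (K x) p μ01) ∧
  (∀ t ∈ Set.Icc (0:ℝ) 1, MemLp (fun x => K x t) p μ01) ∧
  (∀ x₀ ∈ Set.Icc (0:ℝ) 1, ∀ ε > (0:ℝ), ∃ δ > (0:ℝ), ∀ x ∈ Set.Icc (0:ℝ) 1,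
    |x - x₀| < δ → eLpNorm (fun t => K x t - K x₀ t) p μ01 < ENNReal.ofReal ε) ∧
  (∀ t₀ ∈ Set.Icc (0:ℝ) 1, ∀ ε > (0:ℝ), ∃ δ > (0:ℝ), ∀ t ∈ Set.Icc (0:ℝ) 1,
    |t - t₀| < δ → eLpNorm (fun x => K x t - K x t₀) p μ01 < ENNReal.ofReal ε)

/-- The norm of the space `G_p(M₂)` (as an extended real number). -/
def gpNorm (p : ℝ≥0∞) (K : ℝ → ℝ → M2) : ℝ≥0∞ :=
  max (⨆ x ∈ Set.Icc (0:ℝ) 1, eLpNorm (K x) p μ01)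
      (⨆ t ∈ Set.Icc (0:ℝ) 1, eLpNorm (fun x => K x t) p μ01)


/-- `H ∈ L_p((-1,1),M₂)` is the sum of the series
`Σ_{n∈ℤ} (α_n e^{-2λ_n sB} - e^{-π(2n+1) sB})` (in the sense of symmetric partial sums for
`p > 1` and of Cesàro means for `p = 1`). -/
def IsHSum (p : ℝ≥0∞) (lam al : ℤ → ℝ) (H : ℝ → M2) : Prop :=
  MemLp H p μ11 ∧
  (1 < p → Tendsto (fun N : ℕ => eLpNorm (fun s : ℝ =>
      (∑ n ∈ Finset.Icc (-(N:ℤ)) (N:ℤ),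
        ((al n : ℂ) • expB (2 * (lam n : ℂ) * (s : ℂ)) -
          expB (Real.pi * (2 * (n : ℂ) + 1) * (s : ℂ)))) - H s) p μ11)
    atTop (nhds 0)) ∧
  (p = 1 → Tendsto (fun N : ℕ => eLpNorm (fun s : ℝ =>
      ((N : ℂ)⁻¹ • ∑ k ∈ Finset.Icc 1 N, ∑ n ∈ Finset.Icc (-(k:ℤ)) (k:ℤ),
        ((al n : ℂ) • expB (2 * (lam n : ℂ) * (s : ℂ)) -
          expB (Real.pi * (2 * (n : ℂ) + 1) * (s : ℂ)))) - H s) 1 μ11)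
    atTop (nhds 0))

namespace S10

abbrev TT := AddCircle (1:ℝ)
abbrev nu : Measure TT := AddCircle.haarAddCircle (T := 1)

lemma trig_ineq_aux (p : ℝ) (hp : 1 < p) (hp2 : p ≤ 2) : ∃ A B : ℝ, 0 ≤ A ∧ 0 ≤ B ∧
    ∀ θ : ℝ, |θ| < Real.pi / 2 → 1 ≤ A * (Real.cos θ) ^ p - B * Real.cos (θ * p) := by
  have hpi := Real.pi_pos
  have hc : Real.cos (Real.pi / 2 * p) < 0 :=
    Real.cos_neg_of_pi_div_two_lt_of_lt (by nlinarith) (by nlinarith)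
  obtain ⟨c, hc0, hc1⟩ : ∃ c : ℝ, 0 < c ∧ Real.cos (Real.pi / 2 * p) < -c :=
    ⟨-Real.cos (Real.pi / 2 * p) / 2, by linarith, by linarith⟩
  have hcont : ContinuousAt (fun θ : ℝ => Real.cos (θ * p)) (Real.pi / 2) := by fun_prop
  have hev := hcont.eventually (gt_mem_nhds hc1)
  obtain ⟨ε, hε, hball⟩ := Metric.eventually_nhds_iff.1 hev
  set d := min (ε / 2) (Real.pi / 4) with hd
  have hd0 : 0 < d := lt_min (by linarith) (by linarith)
  have hdε : d < ε := lt_of_le_of_lt (min_le_left _ _) (by linarith)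
  have hd4 : d ≤ Real.pi / 4 := min_le_right _ _
  have hcos0 : 0 < Real.cos (Real.pi / 2 - d) :=
    Real.cos_pos_of_mem_Ioo ⟨by linarith, by linarith⟩
  have hpos : 0 < (Real.cos (Real.pi / 2 - d)) ^ p := Real.rpow_pos_of_pos hcos0 _
  refine ⟨(1 + c⁻¹) / (Real.cos (Real.pi / 2 - d)) ^ p, c⁻¹, by positivity, by positivity, ?_⟩
  intro θ hθ
  have e1 : Real.cos θ = Real.cos |θ| := (Real.cos_abs θ).symm
  have e2 : Real.cos (θ * p) = Real.cos (|θ| * p) := by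
    rw [← Real.cos_abs (θ * p), abs_mul, abs_of_pos (show 0 < p by linarith)]
  rw [e1, e2]
  have hcosn : 0 ≤ Real.cos |θ| :=
    Real.cos_nonneg_of_neg_pi_div_two_le_of_le (by linarith [abs_nonneg θ]) hθ.le
  have hcp : 0 ≤ (Real.cos |θ|) ^ p := Real.rpow_nonneg hcosn _
  rcases le_or_gt |θ| (Real.pi / 2 - d) with h | h
  · have h1 : Real.cos (Real.pi / 2 - d) ≤ Real.cos |θ| :=
      Real.cos_le_cos_of_nonneg_of_le_pi (abs_nonneg θ) (by linarith) h
    have h2 : (Real.cos (Real.pi / 2 - d)) ^ p ≤ (Real.cos |θ|) ^ p :=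
      Real.rpow_le_rpow hcos0.le h1 (by linarith)
    have h3 : 1 + c⁻¹ ≤ (1 + c⁻¹) / (Real.cos (Real.pi / 2 - d)) ^ p * (Real.cos |θ|) ^ p := by
      rw [div_mul_eq_mul_div, le_div_iff₀ hpos]
      gcongr
    have h4 : c⁻¹ * Real.cos (|θ| * p) ≤ c⁻¹ * 1 := by
      gcongr; exact Real.cos_le_one _
    linarith
  · have h1 : Real.cos (|θ| * p) < -c := by
      apply hball
      rw [Real.dist_eq, abs_lt]; constructor <;> linarith
    have h2 : c⁻¹ * Real.cos (|θ| * p) ≤ c⁻¹ * (-c) := by gcongr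
    have h3 : c⁻¹ * (-c) = -1 := by field_simp
    have h4 : 0 ≤ (1 + c⁻¹) / (Real.cos (Real.pi / 2 - d)) ^ p * (Real.cos |θ|) ^ p := by
      positivity
    linarith

lemma trig_ineq (p : ℝ) (hp : 1 < p) (hp2 : p ≤ 2) : ∃ A B : ℝ, 0 ≤ A ∧ 0 ≤ B ∧
    ∀ w : ℂ, 0 < w.re → ‖w‖ ^ p ≤ A * w.re ^ p - B * (w ^ (p : ℂ)).re := by
  obtain ⟨A, B, hA, hB, h⟩ := trig_ineq_aux p hp hp2
  refine ⟨A, B, hA, hB, fun w hw => ?_⟩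
  have h1 := h (arg w) (Complex.abs_arg_lt_pi_div_two_iff.2 (Or.inl hw))
  have hre : w.re = ‖w‖ * Real.cos (arg w) := (Complex.norm_mul_cos_arg w).symm
  have hcos : 0 ≤ Real.cos (arg w) := by
    by_contra hh
    push Not at hh
    have := norm_nonneg w
    nlinarith
  rw [Complex.cpow_ofReal_re, hre, Real.mul_rpow (norm_nonneg _) hcos]
  have : 0 ≤ ‖w‖ ^ p := by positivity
  nlinarith

lemma circleAverage_eq (f : ℂ → ℂ) : Real.circleAverage f 0 1 = ∫ x : TT, f (fourier 1 x) ∂nu := by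
  rw [AddCircle.integral_haarAddCircle, Real.circleAverage, ← AddCircle.intervalIntegral_preimage 1 0]
  have : (∫ a in (0:ℝ)..0 + 1, f (fourier 1 (a : TT))) =
      ∫ a in (0:ℝ)..1, f (circleMap 0 1 (a * (2 * Real.pi))) := by
    rw [zero_add]
    congr 1; ext a
    rw [fourier_coe_apply]
    congr 1
    simp [circleMap]
    congr 1; ring
  rw [this, intervalIntegral.integral_comp_mul_right (fun x => f (circleMap 0 1 x)) (by positivity)]
  simp

lemma re_pos_of_circle (F : ℂ → ℂ) (hF : Differentiable ℂ F) (δ : ℝ)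
    (h : ∀ z : ℂ, ‖z‖ = 1 → δ ≤ (F z).re) (z : ℂ) (hz : ‖z‖ ≤ 1) : δ ≤ (F z).re := by
  have h1 : DiffContOnCl ℂ (fun z => cexp (-F z)) (Metric.ball 0 1) :=
    (show Differentiable ℂ (fun z => cexp (-F z)) by fun_prop).diffContOnCl
  have := Complex.norm_le_of_forall_mem_frontier_norm_le Metric.isBounded_ball h1
    (C := Real.exp (-δ)) (z := z) ?_ ?_
  · rw [Complex.norm_exp, Real.exp_le_exp, neg_re] at this
    linarith
  · intro z hz
    rw [frontier_ball _ one_ne_zero] at hz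
    rw [Complex.norm_exp, Real.exp_le_exp, neg_re]
    linarith [h z (by simpa using hz)]
  · rw [closure_ball _ one_ne_zero]; simpa using hz

lemma norm_fourier (n : ℤ) (x : TT) : ‖fourier n x‖ = 1 := by
  rw [fourier_apply]; exact Circle.norm_coe _

lemma cont_integrable {f : TT → ℝ} (hf : Continuous f) : Integrable f nu :=
  hf.integrable_of_hasCompactSupport (HasCompactSupport.of_compactSpace f)

lemma cont_integrableC {f : TT → ℂ} (hf : Continuous f) : Integrable f nu :=
  hf.integrable_of_hasCompactSupport (HasCompactSupport.of_compactSpace f)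

/-- Riesz inequality for functions with positive real part. -/
lemma riesz_pos (p : ℝ) (hp : 1 < p) (hp2 : p ≤ 2) : ∃ A : ℝ, 0 ≤ A ∧
    ∀ (F : ℂ → ℂ) (δ : ℝ), Differentiable ℂ F → 0 < δ → (∀ z : ℂ, ‖z‖ = 1 → δ ≤ (F z).re) →
      (F 0).im = 0 →
      ∫ x : TT, ‖F (fourier 1 x)‖ ^ p ∂nu ≤ A * ∫ x : TT, ((F (fourier 1 x)).re) ^ p ∂nu := by
  obtain ⟨A, B, hA, hB, h⟩ := trig_ineq p hp hp2
  refine ⟨A, hA, fun F δ hF hδ hre him => ?_⟩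
  have hpos := re_pos_of_circle F hF δ hre
  have hslit : ∀ z : ℂ, ‖z‖ ≤ 1 → F z ∈ slitPlane := fun z hz =>
    Or.inl (hδ.trans_le (hpos z hz))
  have hda : ∀ z : ℂ, ‖z‖ ≤ 1 → DifferentiableAt ℂ (fun z => (F z) ^ (p : ℂ)) z := fun z hz =>
    (hF z).cpow (differentiableAt_const _) (hslit z hz)
  have hdc : DiffContOnCl ℂ (fun z => (F z) ^ (p : ℂ)) (Metric.ball 0 |1|) := by
    apply DifferentiableOn.diffContOnCl
    intro z hz
    rw [abs_one, closure_ball _ one_ne_zero] at hz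
    exact (hda z (by simpa using hz)).differentiableWithinAt
  have hav := hdc.circleAverage
  rw [circleAverage_eq] at hav
  have hcF : Continuous fun x : TT => F (fourier 1 x) := hF.continuous.comp (fourier 1).continuous
  have hcp : Continuous fun x : TT => (F (fourier 1 x)) ^ (p : ℂ) := by
    rw [continuous_iff_continuousAt]
    intro x
    exact ((hda _ (norm_fourier 1 x).le).continuousAt).comp (f := fun x : TT => fourier 1 x)
      (fourier 1).continuous.continuousAt
  have hre0 : 0 ≤ ((F 0) ^ (p : ℂ)).re := by
    have : F 0 = ((F 0).re : ℂ) := by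
      apply Complex.ext <;> simp [him]
    rw [this, ← Complex.ofReal_cpow (hδ.le.trans (hpos 0 (by simp))), ofReal_re]
    exact Real.rpow_nonneg (hδ.le.trans (hpos 0 (by simp))) _
  have hreint : ∫ x : TT, ((F (fourier 1 x)) ^ (p : ℂ)).re ∂nu = ((F 0) ^ (p : ℂ)).re := by
    rw [← hav]
    exact integral_re (cont_integrableC hcp)
  have hc1 : Continuous fun x : TT => ‖F (fourier 1 x)‖ ^ p :=
    hcF.norm.rpow_const (fun _ => Or.inr (by linarith))
  have hc2 : Continuous fun x : TT => ((F (fourier 1 x)).re) ^ p :=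
    (continuous_re.comp hcF).rpow_const (fun _ => Or.inr (by linarith))
  have hc3 : Continuous fun x : TT => ((F (fourier 1 x)) ^ (p : ℂ)).re := continuous_re.comp hcp
  calc ∫ x : TT, ‖F (fourier 1 x)‖ ^ p ∂nu
      ≤ ∫ x : TT, (A * ((F (fourier 1 x)).re) ^ p - B * ((F (fourier 1 x)) ^ (p : ℂ)).re) ∂nu := by
        apply integral_mono (cont_integrable hc1)
          (((cont_integrable hc2).const_mul A).sub ((cont_integrable hc3).const_mul B))
        intro x
        exact h _ (hδ.trans_le (hre _ (norm_fourier 1 x)))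
    _ = A * ∫ x : TT, ((F (fourier 1 x)).re) ^ p ∂nu - B * ((F 0) ^ (p : ℂ)).re := by
        rw [integral_sub ((cont_integrable hc2).const_mul A) ((cont_integrable hc3).const_mul B),
          integral_const_mul, integral_const_mul, hreint]
    _ ≤ _ := by nlinarith

end S10

namespace S10

section Lp
variable (p : ℝ≥0∞) [Fact (1 ≤ p)]

abbrev XX := Lp ℂ p nu

lemma XX_integrable {p : ℝ≥0∞} [Fact (1 ≤ p)] (F : XX p) : Integrable F nu :=
  (Lp.memLp F).integrable Fact.out

lemma integral_norm_le {p : ℝ≥0∞} [Fact (1 ≤ p)] (F : XX p) : ∫ x, ‖F x‖ ∂nu ≤ ‖F‖ := by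
  have h : eLpNorm F 1 nu ≤ eLpNorm F p nu :=
    eLpNorm_le_eLpNorm_of_exponent_le Fact.out (Lp.aestronglyMeasurable F)
  rw [Lp.norm_def, integral_norm_eq_lintegral_enorm (Lp.aestronglyMeasurable F),
    ← eLpNorm_one_eq_lintegral_enorm]
  exact ENNReal.toReal_mono (Lp.eLpNorm_ne_top F) h

/-- Fourier coefficient functional. -/
def EE (n : ℤ) : XX p →L[ℂ] ℂ :=
  LinearMap.mkContinuous
    { toFun := fun F => fourierCoeff F n
      map_add' := fun F G => by
        rw [fourierCoeff_congr_ae (Lp.coeFn_add F G)]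
        rw [fourierCoeff.add (XX_integrable F) (XX_integrable G)]
        rfl
      map_smul' := fun c F => by
        rw [fourierCoeff_congr_ae (Lp.coeFn_smul c F)]
        exact fourierCoeff.const_smul _ _ _ } 1 (fun F => by
    rw [one_mul]
    refine le_trans ?_ (integral_norm_le F)
    refine (norm_integral_le_integral_norm _).trans (le_of_eq ?_)
    congr 1; ext x
    rw [norm_smul, norm_fourier, one_mul])

lemma EE_apply (n : ℤ) (F : XX p) : EE p n F = fourierCoeff F n := rfl

lemma EE_phi (n m : ℤ) : EE p n (fourierLp p m) = if n = m then 1 else 0 := by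
  rw [EE_apply, fourierCoeff_congr_ae (coeFn_fourierLp p m), fourierCoeff_fourier, Pi.single_apply]

variable {p}

lemma dense_phi (hp : p ≠ ∞) :
    Dense (Submodule.span ℂ (range (fourierLp (T := 1) p)) : Set (XX p)) := by
  have := span_fourierLp_closure_eq_top (T := 1) hp
  exact (Submodule.dense_iff_topologicalClosure_eq_top).2 this

lemma clm_ext (hp : p ≠ ∞) {Z : Type*} [NormedAddCommGroup Z] [NormedSpace ℂ Z]
    {f g : XX p →L[ℂ] Z} (h : ∀ n, f (fourierLp p n) = g (fourierLp p n)) : f = g := by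
  apply ContinuousLinearMap.ext_on (dense_phi hp)
  rintro _ ⟨n, rfl⟩
  exact h n

variable (p)
def tau (t : TT) : XX p →ₗᵢ[ℂ] XX p :=
  Lp.compMeasurePreservingₗᵢ ℂ (fun x : TT => x - t) (measurePreserving_sub_right nu t)

variable {p}
lemma continuous_tau (hp : p ≠ ∞) (F : XX p) : Continuous fun t => tau p t F := by
  let g : C(TT, C(TT, TT)) :=
    (ContinuousMap.mk (fun a : TT × TT => a.2 - a.1) (by fun_prop)).curry
  exact (continuous_const (y := F)).compMeasurePreservingLp g.continuous
    (fun t => measurePreserving_sub_right nu t) hp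

lemma tau_phi (t : TT) (n : ℤ) :
    tau p t (fourierLp p n) = (fourier (-n) t : ℂ) • fourierLp p n := by
  apply Lp.ext
  have h1 := Lp.coeFn_compMeasurePreserving (fourierLp p n) (measurePreserving_sub_right nu t)
  have h2 := (measurePreserving_sub_right nu t).quasiMeasurePreserving.ae_eq_comp (coeFn_fourierLp p n)
  have h3 := Lp.coeFn_smul (fourier (-n) t : ℂ) (fourierLp (T := 1) p n)
  filter_upwards [h1, h2, h3, coeFn_fourierLp p n] with x h1 h2 h3 h4
  rw [h3, Pi.smul_apply, h4]
  refine h1.trans (h2.trans ?_)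
  have e : n • (x - t) = n • x + (-n) • t := by rw [smul_sub, neg_smul, sub_eq_add_neg]
  simp only [Function.comp, smul_eq_mul, fourier_apply]
  rw [e, AddCircle.toCircle_add, Circle.coe_mul, mul_comm]

lemma conv_integrable (hp : p ≠ ∞) {k : TT → ℂ} (hk : Integrable k nu) (F : XX p) :
    Integrable (fun t => k t • tau p t F) nu := by
  refine (hk.norm.mul_const ‖F‖).mono' (hk.1.smul (continuous_tau hp F).aestronglyMeasurable) ?_
  filter_upwards with t
  rw [norm_smul, LinearIsometry.norm_map]

def conv (hp : p ≠ ∞) (k : TT → ℂ) (hk : Integrable k nu) : XX p →L[ℂ] XX p :=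
  LinearMap.mkContinuous
    { toFun := fun F => ∫ t, k t • tau p t F ∂nu
      map_add' := fun F G => by
        simp only [map_add, smul_add]
        exact integral_add (conv_integrable hp hk F) (conv_integrable hp hk G)
      map_smul' := fun c F => by
        simp only [map_smul, RingHom.id_apply]
        rw [← integral_smul]
        congr 1; ext t
        rw [smul_comm] } (∫ t, ‖k t‖ ∂nu) (fun F => by
    refine (norm_integral_le_integral_norm _).trans (le_of_eq ?_)
    rw [← integral_mul_const]
    congr 1; ext x
    rw [norm_smul, LinearIsometry.norm_map])

lemma norm_conv_le (hp : p ≠ ∞) (k : TT → ℂ) (hk : Integrable k nu) :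
    ‖conv (p := p) hp k hk‖ ≤ ∫ t, ‖k t‖ ∂nu :=
  LinearMap.mkContinuous_norm_le _ (integral_nonneg fun _ => norm_nonneg _) _

lemma conv_phi (hp : p ≠ ∞) (k : TT → ℂ) (hk : Integrable k nu) (n : ℤ) :
    conv hp k hk (fourierLp p n) = fourierCoeff k n • fourierLp p n := by
  change ∫ t, k t • tau p t (fourierLp p n) ∂nu = _
  simp only [tau_phi, smul_smul]
  rw [integral_smul_const, fourierCoeff]
  congr 1
  congr 1; ext t
  rw [smul_eq_mul, mul_comm]

lemma EE_conv (hp : p ≠ ∞) (k : TT → ℂ) (hk : Integrable k nu) (n : ℤ) (F : XX p) :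
    EE p n (conv hp k hk F) = fourierCoeff k n * EE p n F := by
  have : (EE p n).comp (conv hp k hk) = fourierCoeff k n • EE p n := by
    apply clm_ext hp
    intro m
    simp only [ContinuousLinearMap.comp_apply, conv_phi, map_smul, EE_phi,
      smul_apply, smul_eq_mul]
    split_ifs with h
    · rw [h]
    · simp
  exact DFunLike.congr_fun this F

/-- Finite Fourier multiplier. -/
def mult (p : ℝ≥0∞) [Fact (1 ≤ p)] (s : Finset ℤ) (w : ℤ → ℂ) : XX p →L[ℂ] XX p :=
  ∑ n ∈ s, w n • (EE p n).smulRight (fourierLp p n)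

lemma mult_apply (s : Finset ℤ) (w : ℤ → ℂ) (F : XX p) :
    mult p s w F = ∑ n ∈ s, (w n * EE p n F) • fourierLp p n := by
  simp [mult, smul_smul]

lemma mult_phi (s : Finset ℤ) (w : ℤ → ℂ) (m : ℤ) :
    mult p s w (fourierLp p m) = if m ∈ s then w m • fourierLp p m else 0 := by
  rw [mult_apply]
  simp only [EE_phi, mul_ite, mul_one, mul_zero, ite_smul, zero_smul]
  rw [Finset.sum_ite_eq' s m]

/-- The continuous function representing `mult`. -/
def multC (s : Finset ℤ) (w : ℤ → ℂ) (F : XX p) : C(TT, ℂ) :=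
  ∑ n ∈ s, (w n * EE p n F) • fourier n

lemma toLp_multC (s : Finset ℤ) (w : ℤ → ℂ) (F : XX p) :
    ContinuousMap.toLp p nu ℂ (multC s w F) = mult p s w F := by
  rw [mult_apply, multC, map_sum]
  simp only [map_smul]

lemma multC_apply (s : Finset ℤ) (w : ℤ → ℂ) (F : XX p) (x : TT) :
    multC s w F x = ∑ n ∈ s, (w n * EE p n F) * fourier n x := by
  simp [multC, ContinuousMap.coe_sum]

end Lp

section mulop

variable {α : Type*} [MeasurableSpace α] {μ : Measure α} {p : ℝ≥0∞} [Fact (1 ≤ p)]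

lemma memLp_mul (b : α → ℂ) (hb : AEStronglyMeasurable b μ) (C : ℝ) (hC : ∀ᵐ x ∂μ, ‖b x‖ ≤ C)
    (F : Lp ℂ p μ) : MemLp (fun x => b x * F x) p μ :=
  MemLp.of_le_mul (c := C) (Lp.memLp F) (hb.mul (Lp.aestronglyMeasurable F)) (by
    filter_upwards [hC] with x hx
    rw [norm_mul]; gcongr)

def mulL (b : α → ℂ) (hb : AEStronglyMeasurable b μ) (C : ℝ) (hC : ∀ᵐ x ∂μ, ‖b x‖ ≤ C) :
    Lp ℂ p μ →L[ℂ] Lp ℂ p μ :=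
  LinearMap.mkContinuous
    { toFun := fun F => (memLp_mul b hb C hC F).toLp
      map_add' := fun F G => by
        apply Lp.ext
        filter_upwards [(memLp_mul b hb C hC F).coeFn_toLp, (memLp_mul b hb C hC G).coeFn_toLp,
          (memLp_mul b hb C hC (F + G)).coeFn_toLp, Lp.coeFn_add F G,
          Lp.coeFn_add (memLp_mul b hb C hC F).toLp (memLp_mul b hb C hC G).toLp]
          with x h1 h2 h3 h4 h5
        rw [h5, h3, Pi.add_apply, h1, h2, h4, Pi.add_apply, mul_add]
      map_smul' := fun c F => by
        apply Lp.ext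
        filter_upwards [(memLp_mul b hb C hC F).coeFn_toLp,
          (memLp_mul b hb C hC (c • F)).coeFn_toLp, Lp.coeFn_smul c F,
          Lp.coeFn_smul c (memLp_mul b hb C hC F).toLp]
          with x h1 h3 h4 h5
        simp only [RingHom.id_apply]
        rw [h5, h3, Pi.smul_apply, h1, h4, Pi.smul_apply, smul_eq_mul, smul_eq_mul]
        ring } C (fun F => by
    apply Lp.norm_le_mul_norm_of_ae_le_mul
    filter_upwards [(memLp_mul b hb C hC F).coeFn_toLp, hC] with x h1 h2
    simp only [LinearMap.coe_mk, AddHom.coe_mk]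
    rw [h1, norm_mul]
    gcongr)

lemma mulL_ae (b : α → ℂ) (hb : AEStronglyMeasurable b μ) (C : ℝ) (hC : ∀ᵐ x ∂μ, ‖b x‖ ≤ C)
    (F : Lp ℂ p μ) : mulL b hb C hC F =ᵐ[μ] fun x => b x * F x :=
  (memLp_mul b hb C hC F).coeFn_toLp

lemma norm_mulL_le (b : α → ℂ) (hb : AEStronglyMeasurable b μ) (C : ℝ) (hC : ∀ᵐ x ∂μ, ‖b x‖ ≤ C)
    (h0 : 0 ≤ C) : ‖(mulL b hb C hC : Lp ℂ p μ →L[ℂ] Lp ℂ p μ)‖ ≤ C :=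
  LinearMap.mkContinuous_norm_le _ h0 _

end mulop

end S10

namespace S10

lemma sum_Icc_symm {A : Type*} [AddCommMonoid A] (a : ℤ → A) (k : ℕ) :
    ∑ n ∈ Finset.Icc (-(k:ℤ)) k, a n
      = a 0 + ∑ j ∈ Finset.range k, (a ((j:ℤ) + 1) + a (-((j:ℤ) + 1))) := by
  induction k with
  | zero => simp
  | succ k ih =>
    have h : Finset.Icc (-((k + 1 : ℕ):ℤ)) ((k + 1 : ℕ) : ℤ)
        = insert ((k:ℤ) + 1) (insert (-((k:ℤ) + 1)) (Finset.Icc (-(k:ℤ)) k)) := by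
      ext x
      simp only [Finset.mem_Icc, Finset.mem_insert]
      push_cast
      omega
    rw [h, Finset.sum_insert, Finset.sum_insert, ih, Finset.sum_range_succ]
    · abel
    · simp
    · simp only [Finset.mem_Icc, Finset.mem_insert]
      omega

lemma fejer_comb {A : Type*} [AddCommMonoid A] (a : ℤ → A) (N : ℕ) :
    ∑ j ∈ Finset.range N, ∑ l ∈ Finset.range N, a ((j:ℤ) - l)
      = ∑ k ∈ Finset.range N, ∑ n ∈ Finset.Icc (-(k:ℤ)) k, a n := by
  induction N with
  | zero => simp
  | succ N ih =>
    rw [Finset.sum_range_succ (fun k => ∑ n ∈ Finset.Icc (-(k:ℤ)) k, a n) N, ← ih]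
    simp only [Finset.sum_range_succ _ N]
    rw [Finset.sum_add_distrib, sum_Icc_symm, sub_self]
    have h1 : ∑ j ∈ Finset.range N, a ((j:ℤ) - N) = ∑ j ∈ Finset.range N, a (-((j:ℤ) + 1)) := by
      rw [← Finset.sum_range_reflect]
      refine Finset.sum_congr rfl fun j hj => ?_
      have := Finset.mem_range.1 hj
      congr 1
      omega
    have h2 : ∑ j ∈ Finset.range N, a ((N:ℤ) - j) = ∑ j ∈ Finset.range N, a ((j:ℤ) + 1) := by
      rw [← Finset.sum_range_reflect]
      refine Finset.sum_congr rfl fun j hj => ?_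
      have := Finset.mem_range.1 hj
      congr 1
      omega
    rw [h1, h2, Finset.sum_add_distrib]
    abel

section
variable {p : ℝ≥0∞} [Fact (1 ≤ p)]

lemma norm_toLp_eq (hp : p ≠ ∞) (f : C(TT, ℂ)) :
    ‖ContinuousMap.toLp p nu ℂ f‖ = (∫ x, ‖f x‖ ^ p.toReal ∂nu) ^ p.toReal⁻¹ := by
  have hp0 : p ≠ 0 := (one_pos.trans_le (Fact.out : 1 ≤ p)).ne'
  rw [Lp.norm_def, eLpNorm_congr_ae (ContinuousMap.coeFn_toLp nu f),
    MemLp.eLpNorm_eq_integral_rpow_norm hp0 hp, ENNReal.toReal_ofReal]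
  · exact Real.rpow_nonneg (integral_nonneg fun _ => Real.rpow_nonneg (norm_nonneg _) _) _
  · exact (memLp_congr_ae (ContinuousMap.coeFn_toLp (𝕜 := ℂ) (p := p) nu f)).1 (Lp.memLp _)

lemma norm_phi_le (n : ℤ) : ‖fourierLp (T := 1) p n‖ ≤ 1 := by
  have := Lp.norm_le_of_ae_bound (f := fourierLp (T := 1) p n) (C := 1) zero_le_one (by
    filter_upwards [coeFn_fourierLp (T := 1) p n] with x hx
    rw [hx, norm_fourier])
  have h1 : measureUnivNNReal (AddCircle.haarAddCircle (T := 1)) = 1 := by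
    simp [measureUnivNNReal]
  simpa [h1] using this

lemma norm_EE_le (n : ℤ) (F : XX p) : ‖EE p n F‖ ≤ ‖F‖ := by
  refine ((EE p n).le_opNorm F).trans ?_
  have : ‖EE p n‖ ≤ 1 := LinearMap.mkContinuous_norm_le _ zero_le_one _
  nlinarith [norm_nonneg F]

variable (p)
/-- Symmetric partial sum operator. -/
def SS (k : ℕ) : XX p →L[ℂ] XX p := mult p (Finset.Icc (-(k:ℤ)) k) (fun _ => 1)

/-- Fejér operator -/
def fejer (N : ℕ) : XX p →L[ℂ] XX p := ((N:ℂ) + 1)⁻¹ • ∑ k ∈ Finset.range (N + 1), SS p k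

/-- Fejér kernel -/
def fejK (N : ℕ) : C(TT, ℂ) :=
  ((N:ℂ) + 1)⁻¹ • ∑ j ∈ Finset.range (N + 1), ∑ l ∈ Finset.range (N + 1), fourier ((j:ℤ) - l)

variable {p}

lemma sum_sq_fourier (N : ℕ) (x : TT) :
    ∑ j ∈ Finset.range (N + 1), ∑ l ∈ Finset.range (N + 1), fourier ((j:ℤ) - l) x
      = ((‖∑ j ∈ Finset.range (N + 1), fourier (j:ℤ) x‖ ^ 2 : ℝ) : ℂ) := by
  rw [← Complex.normSq_eq_norm_sq, ← Complex.mul_conj, map_sum, Finset.sum_mul_sum]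
  refine Finset.sum_congr rfl fun j _ => Finset.sum_congr rfl fun l _ => ?_
  rw [sub_eq_add_neg, fourier_add, fourier_neg]

lemma fejK_apply (N : ℕ) (x : TT) : fejK N x =
    (((N:ℝ) + 1)⁻¹ * ‖∑ j ∈ Finset.range (N + 1), fourier (j:ℤ) x‖ ^ 2 : ℝ) := by
  simp only [fejK, ContinuousMap.smul_apply, ContinuousMap.coe_sum, Finset.sum_apply]
  rw [sum_sq_fourier]
  push_cast
  rfl

lemma fejK_integrable (N : ℕ) : Integrable (fejK N) nu := cont_integrableC (fejK N).continuous

lemma fourierCoeff_fejK (N : ℕ) (m : ℤ) : fourierCoeff (fejK N) m =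
    ((N:ℂ) + 1)⁻¹ * ∑ k ∈ Finset.range (N + 1), if m ∈ Finset.Icc (-(k:ℤ)) k then 1 else 0 := by
  have h : (fejK N : TT → ℂ) =ᵐ[nu] (ContinuousMap.toLp 1 nu ℂ (fejK N) : XX 1) :=
    (ContinuousMap.coeFn_toLp nu (fejK N)).symm
  rw [fourierCoeff_congr_ae h, ← EE_apply, fejK, fejer_comb]
  simp only [map_smul, map_sum, smul_eq_mul]
  congr 1
  refine Finset.sum_congr rfl fun k _ => ?_
  simp only [EE_phi]
  rw [Finset.sum_ite_eq]

lemma fejer_eq_conv (hp : p ≠ ∞) (N : ℕ) : fejer p N = conv hp (fejK N) (fejK_integrable N) := by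
  apply clm_ext hp
  intro m
  rw [conv_phi, fourierCoeff_fejK]
  simp only [fejer, smul_apply, sum_apply, SS, mult_phi]
  rw [mul_smul, Finset.sum_smul]
  congr 1
  refine Finset.sum_congr rfl fun k _ => ?_
  split_ifs <;> simp

lemma norm_fejer_le (hp : p ≠ ∞) (N : ℕ) : ‖fejer p N‖ ≤ 1 := by
  rw [fejer_eq_conv hp]
  refine (norm_conv_le _ _ _).trans ?_
  have h0 : fourierCoeff (fejK N) 0 = 1 := by
    rw [fourierCoeff_fejK]
    simp
    exact inv_mul_cancel₀ (by exact_mod_cast Nat.succ_ne_zero N)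
  have h1 : ((∫ t, ‖fejK N t‖ ∂nu : ℝ) : ℂ) = 1 := by
    rw [← h0, fourierCoeff, ← integral_complex_ofReal]
    congr 1; ext t
    rw [neg_zero, fourier_zero, one_smul, fejK_apply, Complex.norm_real, Real.norm_of_nonneg (by positivity)]
  exact le_of_eq (by exact_mod_cast h1)

/-- one-sided Fejér operator -/
def PF (p : ℝ≥0∞) [Fact (1 ≤ p)] (N : ℕ) : XX p →L[ℂ] XX p :=
  ((N:ℂ) + 1)⁻¹ • ∑ k ∈ Finset.range (N + 1), mult p (Finset.Icc 0 (k:ℤ)) (fun _ => 1)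

lemma sum_Icc_pos {A : Type*} [AddCommMonoid A] (a : ℤ → A) (k : ℕ) :
    ∑ n ∈ Finset.Icc (0:ℤ) k, a n = a 0 + ∑ j ∈ Finset.range k, a ((j:ℤ) + 1) := by
  induction k with
  | zero => simp
  | succ k ih =>
    have h : Finset.Icc (0:ℤ) ((k + 1 : ℕ) : ℤ)
        = insert ((k:ℤ) + 1) (Finset.Icc (0:ℤ) k) := by
      ext x
      simp only [Finset.mem_Icc, Finset.mem_insert]
      push_cast
      omega
    rw [h, Finset.sum_insert, ih, Finset.sum_range_succ]
    · abel
    · simp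

end

lemma avg_half {Z : Type*} [AddCommGroup Z] [Module ℂ Z] (v : ℤ → Z) (N : ℕ) :
    ((N:ℂ) + 1)⁻¹ • ∑ k ∈ Finset.range (N + 1), (v 0 + ∑ j ∈ Finset.range k, v ((j:ℤ) + 1))
    = (2:ℂ)⁻¹ • (((N:ℂ) + 1)⁻¹ • ∑ k ∈ Finset.range (N + 1),
        (v 0 + ∑ j ∈ Finset.range k, (2:ℂ) • v ((j:ℤ) + 1)) + v 0) := by
  have hN : (N:ℂ) + 1 ≠ 0 := by exact_mod_cast Nat.succ_ne_zero N
  simp only [← Finset.smul_sum, Finset.sum_add_distrib, Finset.sum_const, Finset.card_range,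
    ← Nat.cast_smul_eq_nsmul ℂ]
  push_cast
  generalize ∑ k ∈ Finset.range (N + 1), ∑ j ∈ Finset.range k, v ((j:ℤ) + 1) = w
  simp only [smul_add, smul_smul]
  rw [inv_mul_cancel₀ hN, one_smul]
  have : (2:ℂ)⁻¹ * (((N:ℂ) + 1)⁻¹ * 2) = ((N:ℂ) + 1)⁻¹ := by ring
  rw [this, mul_one]
  have h0 : v 0 = (2:ℂ)⁻¹ • v 0 + (2:ℂ)⁻¹ • v 0 := by
    rw [← add_smul]; norm_num
  nth_rewrite 1 [h0]
  abel

set_option maxHeartbeats 1000000 in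
lemma PF_pos (p : ℝ≥0∞) [Fact (1 ≤ p)] (h1 : 1 < p) (h2 : p ≤ 2) : ∃ C : ℝ, 0 ≤ C ∧
    ∀ (N : ℕ) (G : XX p) (g : TT → ℝ), (∀ x, 0 ≤ g x) → (G =ᵐ[nu] fun x => (g x : ℂ)) →
      ‖PF p N G‖ ≤ C * ‖G‖ := by
  have hp : p ≠ ∞ := (h2.trans_lt (by simp)).ne
  have hr1 : 1 < p.toReal := by
    rw [← ENNReal.toReal_one]; exact (ENNReal.toReal_lt_toReal (by simp) hp).2 h1
  have hr2 : p.toReal ≤ 2 := by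
    have := (ENNReal.toReal_le_toReal hp (by simp)).2 h2
    simpa using this
  obtain ⟨A, hA, hR⟩ := riesz_pos p.toReal hr1 hr2
  set A' := A ^ p.toReal⁻¹ with hA'
  have hA'0 : 0 ≤ A' := Real.rpow_nonneg hA _
  refine ⟨A' + 1, by linarith, fun N G g hg hG => ?_⟩
  set e : ℤ → ℂ := fun n => EE p n G with he
  have hconj : ∀ n, e (-n) = (starRingEnd ℂ) (e n) := by
    intro n
    simp only [he, EE_apply]
    rw [fourierCoeff_congr_ae hG, fourierCoeff, fourierCoeff,
      ← integral_conj]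
    congr 1; ext t
    simp
  have he0 : (e 0).im = 0 := by
    have := hconj 0
    rw [neg_zero] at this
    exact Complex.conj_eq_iff_im.1 this.symm
  -- the analytic function
  set Fz : ℂ → ℂ := fun z => ((N:ℂ) + 1)⁻¹ * ∑ k ∈ Finset.range (N + 1),
    (e 0 + ∑ j ∈ Finset.range k, 2 * e ((j:ℤ) + 1) * z ^ (j + 1)) with hFz
  have hFd : Differentiable ℂ Fz := by
    simp only [hFz]; fun_prop
  set u : C(TT, ℂ) := ((N:ℂ) + 1)⁻¹ • ∑ k ∈ Finset.range (N + 1),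
    multC (Finset.Icc (-(k:ℤ)) k) (fun _ => 1) G with hu
  have hu_lp : ContinuousMap.toLp p nu ℂ u = fejer p N G := by
    simp only [hu, fejer, map_smul, map_sum, toLp_multC, smul_apply, sum_apply, SS]
  have hNre : (((N:ℂ) + 1)⁻¹) = (((N:ℝ) + 1)⁻¹ : ℝ) := by push_cast; rfl
  have hux : ∀ x, u x = (((Fz (fourier 1 x)).re : ℝ) : ℂ) := by
    intro x
    simp only [hu, hFz, ContinuousMap.smul_apply, ContinuousMap.coe_sum, Finset.sum_apply, multC_apply,
      smul_eq_mul, one_mul]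
    rw [hNre, Complex.re_ofReal_mul, Complex.ofReal_mul, Complex.re_sum, Complex.ofReal_sum]
    congr 1
    refine Finset.sum_congr rfl fun k _ => ?_
    rw [sum_Icc_symm (fun n => EE p n G * fourier n x), Complex.add_re, Complex.ofReal_add,
      Complex.re_sum, Complex.ofReal_sum]
    congr 1
    · rw [fourier_zero, mul_one]
      apply Complex.ext
      · simp [he]
      · simpa using he0
    · refine Finset.sum_congr rfl fun j _ => ?_
      have e1 : fourier ((j:ℤ) + 1) x = (fourier 1 x) ^ (j + 1) := by
        simp only [fourier_apply]
        rw [one_smul, ← Circle.coe_pow, ← AddCircle.toCircle_nsmul]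
        rw [← natCast_zsmul]; push_cast; rfl
      have e2 := hconj ((j:ℤ) + 1)
      simp only [he] at e2
      rw [e2, fourier_neg, ← map_mul, Complex.add_conj, e1]
      congr 1
      rw [mul_assoc, show (2:ℂ) = ((2:ℝ):ℂ) by simp, Complex.re_ofReal_mul]
  have hu0 : ∀ x : TT, 0 ≤ (Fz (fourier 1 x)).re := by
    intro x
    have hx : u x = (((N:ℝ) + 1)⁻¹ * ∫ t, ‖∑ j ∈ Finset.range (N + 1),
        fourier (j:ℤ) (x - t)‖ ^ 2 * g t ∂nu : ℝ) := by
      simp only [hu, ContinuousMap.smul_apply, ContinuousMap.coe_sum, Finset.sum_apply, multC_apply,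
        smul_eq_mul, one_mul]
      rw [hNre, Complex.ofReal_mul]
      congr 1
      rw [← fejer_comb (fun n => EE p n G * fourier n x), ← integral_complex_ofReal]
      have : ∀ n : ℤ, EE p n G * fourier n x = ∫ t, fourier n (x - t) * G t ∂nu := by
        intro n
        rw [EE_apply, fourierCoeff, ← integral_mul_const]
        congr 1; ext t
        have e : n • (x - t) = n • x + (-n) • t := by rw [smul_sub, neg_smul, sub_eq_add_neg]
        rw [fourier_apply (x := x - t), e, AddCircle.toCircle_add, Circle.coe_mul, smul_eq_mul]
        rw [← fourier_apply, ← fourier_apply]; ring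
      simp only [this]
      have hi : ∀ n : ℤ, Integrable (fun t => fourier n (x - t) * G t) nu := by
        intro n
        refine (XX_integrable G).bdd_mul (c := 1) ?_ ?_
        · exact (show Continuous fun t => fourier n (x - t) by fun_prop).aestronglyMeasurable
        · filter_upwards with t
          rw [norm_fourier]
      simp_rw [← integral_finsetSum (Finset.range (N+1)) (fun l _ => hi _)]
      rw [← integral_finsetSum]
      · apply integral_congr_ae
        filter_upwards [hG] with t ht
        simp only [ht, ← Finset.sum_mul]
        rw [sum_sq_fourier]
        push_cast; rfl
      · intro j _
        exact integrable_finsetSum _ (fun l _ => hi _)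
    rw [hux] at hx
    have := Complex.ofReal_injective hx
    rw [this]
    exact mul_nonneg (by positivity) (integral_nonneg fun t => mul_nonneg (by positivity) (hg t))
  set FC : C(TT, ℂ) := ⟨fun x => Fz (fourier 1 x), hFd.continuous.comp (fourier 1).continuous⟩ with hFC
  set one : C(TT, ℂ) := fourier 0 with hone
  have hone1 : ‖ContinuousMap.toLp p nu ℂ one‖ ≤ 1 := norm_phi_le 0
  have key : ∀ ε : ℝ, 0 < ε → ‖ContinuousMap.toLp p nu ℂ FC‖ ≤ A' * (‖G‖ + ε) + ε := by
    intro ε hε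
    have hsurj : ∀ z : ℂ, ‖z‖ = 1 → ∃ x : TT, fourier 1 x = z := by
      intro z hz
      refine ⟨((arg z / (2 * Real.pi) : ℝ) : TT), ?_⟩
      rw [fourier_coe_apply]
      have := Complex.norm_mul_exp_arg_mul_I z
      rw [hz] at this
      refine Eq.trans ?_ this
      have hpi : (Real.pi : ℂ) ≠ 0 := by exact_mod_cast Real.pi_ne_zero
      push_cast
      rw [one_mul]
      congr 1
      field_simp
    have hq := hR (fun z => Fz z + ε) ε (hFd.add_const _) hε (by
      intro z hz
      obtain ⟨x, rfl⟩ := hsurj z hz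
      simpa using hu0 x) (by
      have : Fz 0 = e 0 := by
        simp only [hFz]
        simp
        have : (N:ℂ) + 1 ≠ 0 := by exact_mod_cast Nat.succ_ne_zero N
        field_simp
      rw [add_im, this, he0]; simp)
    have hl : ‖ContinuousMap.toLp p nu ℂ (FC + (ε:ℂ) • one)‖ ≤
        A' * ‖ContinuousMap.toLp p nu ℂ (u + (ε:ℂ) • one)‖ := by
      rw [norm_toLp_eq hp, norm_toLp_eq hp, hA', ← Real.mul_rpow hA
        (integral_nonneg fun _ => Real.rpow_nonneg (norm_nonneg _) _)]
      apply Real.rpow_le_rpow (integral_nonneg fun _ => Real.rpow_nonneg (norm_nonneg _) _) _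
        (by positivity)
      convert hq using 3
      · simp [hFC, hone]
      · congr 1; ext x
        have : (u + (ε:ℂ) • one) x = (((Fz (fourier 1 x)).re + ε : ℝ) : ℂ) := by
          simp [hux, hone]
        rw [this, Complex.norm_real, Real.norm_of_nonneg (by linarith [hu0 x])]
        simp
    rw [map_add, map_add, map_smul, hu_lp] at hl
    have hG' : ‖fejer p N G‖ ≤ ‖G‖ := by
      refine ((fejer p N).le_opNorm G).trans ?_
      nlinarith [norm_nonneg G, norm_fejer_le hp N]
    have hε1 : ‖(ε:ℂ) • ContinuousMap.toLp p nu ℂ one‖ ≤ ε := by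
      rw [norm_smul, Complex.norm_real, Real.norm_of_nonneg hε.le]
      nlinarith
    have h3 : ‖fejer p N G + (ε:ℂ) • ContinuousMap.toLp p nu ℂ one‖ ≤ ‖G‖ + ε :=
      (norm_add_le _ _).trans (add_le_add hG' hε1)
    have h4 := norm_sub_le (ContinuousMap.toLp p nu ℂ FC + (ε:ℂ) • ContinuousMap.toLp p nu ℂ one)
      ((ε:ℂ) • ContinuousMap.toLp p nu ℂ one)
    rw [add_sub_cancel_right] at h4
    have h5 := mul_le_mul_of_nonneg_left h3 hA'0
    linarith
  have key2 : ‖ContinuousMap.toLp p nu ℂ FC‖ ≤ A' * ‖G‖ := by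
    have ht : Tendsto (fun ε : ℝ => A' * (‖G‖ + ε) + ε) (nhdsWithin 0 (Ioi 0)) (nhds (A' * ‖G‖)) := by
      have : Tendsto (fun ε : ℝ => A' * (‖G‖ + ε) + ε) (nhds 0) (nhds (A' * (‖G‖ + 0) + 0)) :=
        Continuous.tendsto (by fun_prop) 0
      simp only [add_zero] at this
      exact this.mono_left nhdsWithin_le_nhds
    exact ge_of_tendsto ht (by filter_upwards [self_mem_nhdsWithin] with ε hε using key ε hε)
  have hPF : PF p N G = (2:ℂ)⁻¹ • (ContinuousMap.toLp p nu ℂ FC + e 0 • fourierLp p 0) := by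
    have hFCe : FC = ((N:ℂ) + 1)⁻¹ • ∑ k ∈ Finset.range (N + 1),
        (e 0 • fourier 0 + ∑ j ∈ Finset.range k, (2 * e ((j:ℤ) + 1)) • fourier ((j:ℤ) + 1)) := by
      ext x
      simp only [hFC, hFz, ContinuousMap.coe_mk, ContinuousMap.smul_apply, ContinuousMap.coe_sum,
        Finset.sum_apply, ContinuousMap.add_apply, smul_eq_mul, fourier_zero, mul_one]
      congr 1
      refine Finset.sum_congr rfl fun k _ => ?_
      congr 1
      refine Finset.sum_congr rfl fun j _ => ?_
      have e1 : fourier ((j:ℤ) + 1) x = (fourier 1 x) ^ (j + 1) := by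
        simp only [fourier_apply]
        rw [one_smul, ← Circle.coe_pow, ← AddCircle.toCircle_nsmul]
        rw [← natCast_zsmul]; push_cast; rfl
      rw [e1]
    have h9 : ContinuousMap.toLp p nu ℂ FC = ((N:ℂ) + 1)⁻¹ • ∑ k ∈ Finset.range (N + 1),
        (e 0 • fourierLp p 0 + ∑ j ∈ Finset.range k,
          (2:ℂ) • (e ((j:ℤ) + 1) • fourierLp p ((j:ℤ) + 1))) := by
      rw [hFCe]
      simp only [map_smul, map_sum, map_add, mul_smul]
    rw [h9]
    simp only [PF, smul_apply, sum_apply, mult_apply, one_mul]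
    rw [← avg_half (fun n => e n • fourierLp p n) N]
    simp only [sum_Icc_pos (fun n => EE p n G • fourierLp p n)]
    rfl
  rw [hPF, norm_smul]
  have h6 : ‖e 0 • fourierLp (T := 1) p 0‖ ≤ ‖G‖ := by
    rw [norm_smul]
    have := norm_EE_le 0 G
    have := norm_phi_le (p := p) 0
    calc _ ≤ ‖G‖ * 1 := by gcongr
      _ = _ := mul_one _
  have h7 := norm_add_le (ContinuousMap.toLp p nu ℂ FC) (e 0 • fourierLp (T := 1) p 0)
  have h8 : ‖(2:ℂ)⁻¹‖ ≤ 1 := by norm_num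
  nlinarith [norm_nonneg (ContinuousMap.toLp p nu ℂ FC + e 0 • fourierLp (T := 1) p 0)]

end S10

namespace S10

lemma PF_part {p : ℝ≥0∞} [Fact (1 ≤ p)] (F : XX p) (g : TT → ℝ) (hm : AEStronglyMeasurable g nu)
    (hg0 : ∀ x, 0 ≤ g x) (hgF : ∀ x, g x ≤ ‖F x‖) :
    ∃ G : XX p, (G =ᵐ[nu] fun x => (g x : ℂ)) ∧ ‖G‖ ≤ ‖F‖ := by
  have hmem : MemLp (fun x => (g x : ℂ)) p nu := by
    refine (Lp.memLp F).of_le (Complex.continuous_ofReal.comp_aestronglyMeasurable hm) ?_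
    filter_upwards with x
    rw [Complex.norm_real, Real.norm_of_nonneg (hg0 x)]
    exact hgF x
  refine ⟨hmem.toLp, hmem.coeFn_toLp, ?_⟩
  apply Lp.norm_le_norm_of_ae_le
  filter_upwards [hmem.coeFn_toLp] with x hx
  rw [hx, Complex.norm_real, Real.norm_of_nonneg (hg0 x)]
  exact hgF x

lemma PF_bdd (p : ℝ≥0∞) [Fact (1 ≤ p)] (h1 : 1 < p) (h2 : p ≤ 2) : ∃ C : ℝ, 0 ≤ C ∧
    ∀ (N : ℕ), ‖PF p N‖ ≤ C := by
  obtain ⟨C, hC, h⟩ := PF_pos p h1 h2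
  refine ⟨4 * C, by linarith, fun N => ContinuousLinearMap.opNorm_le_bound _ (by linarith) fun F => ?_⟩
  have hF := Lp.aestronglyMeasurable F
  have part : ∀ c : ℂ →L[ℝ] ℝ, (∀ z, |c z| ≤ ‖z‖) → ∃ G : XX p,
      (G =ᵐ[nu] fun x => ((max (c (F x)) 0 : ℝ) : ℂ)) ∧ ‖PF p N G‖ ≤ C * ‖F‖ := by
    intro c hc
    obtain ⟨G, hG, hGF⟩ := PF_part F (fun x => max (c (F x)) 0)
      ((show Continuous fun z : ℂ => max (c z) 0 by fun_prop).comp_aestronglyMeasurable hF)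
      (fun x => le_max_right _ _)
      (fun x => max_le ((le_abs_self _).trans (hc _)) (norm_nonneg _))
    exact ⟨G, hG, (h N G _ (fun x => le_max_right _ _) hG).trans (by gcongr)⟩
  obtain ⟨G1, hG1, b1⟩ := part reCLM (fun z => by simpa using Complex.abs_re_le_norm z)
  obtain ⟨G2, hG2, b2⟩ := part (-reCLM) (fun z => by simpa using Complex.abs_re_le_norm z)
  obtain ⟨G3, hG3, b3⟩ := part imCLM (fun z => by simpa using Complex.abs_im_le_norm z)
  obtain ⟨G4, hG4, b4⟩ := part (-imCLM) (fun z => by simpa using Complex.abs_im_le_norm z)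
  have hd : F = (G1 - G2) + I • (G3 - G4) := by
    apply Lp.ext
    filter_upwards [hG1, hG2, hG3, hG4, Lp.coeFn_add (G1 - G2) (I • (G3 - G4)),
      Lp.coeFn_sub G1 G2, Lp.coeFn_sub G3 G4, Lp.coeFn_smul I (G3 - G4)] with x a1 a2 a3 a4 a5 a6 a7 a8
    rw [a5, Pi.add_apply, a6, a8, Pi.smul_apply, a7, Pi.sub_apply, Pi.sub_apply, a1, a2, a3, a4]
    have hmax : ∀ t : ℝ, max t 0 - max (-t) 0 = t := fun t => by
      rcases le_total 0 t with ht | ht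
      · rw [max_eq_left ht, max_eq_right (by linarith), sub_zero]
      · rw [max_eq_right ht, max_eq_left (by linarith)]; ring
    rw [← Complex.ofReal_sub, ← Complex.ofReal_sub]
    simp only [neg_apply, reCLM_apply, imCLM_apply, hmax, smul_eq_mul]
    rw [mul_comm, Complex.re_add_im]
  have hPF : PF p N F = (PF p N G1 - PF p N G2) + I • (PF p N G3 - PF p N G4) := by
    conv_lhs => rw [hd]
    simp only [map_add, map_sub, map_smul]
  rw [hPF]
  have n1 := norm_add_le (PF p N G1 - PF p N G2) (I • (PF p N G3 - PF p N G4))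
  have n2 := norm_sub_le (PF p N G1) (PF p N G2)
  have n3 := norm_sub_le (PF p N G3) (PF p N G4)
  rw [norm_smul, Complex.norm_I, one_mul] at n1
  linarith

lemma strong_conv {p : ℝ≥0∞} [Fact (1 ≤ p)] (hp : p ≠ ∞) (D : ℕ → XX p →L[ℂ] XX p) (C : ℝ)
    (hC : ∀ N, ‖D N‖ ≤ C) (S : XX p →L[ℂ] XX p)
    (h : ∀ n, Tendsto (fun N => D N (fourierLp p n)) atTop (nhds (S (fourierLp p n)))) (F : XX p) :
    Tendsto (fun N => D N F) atTop (nhds (S F)) := by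
  have hspan : ∀ G ∈ Submodule.span ℂ (range (fourierLp (T := 1) p)),
      Tendsto (fun N => D N G) atTop (nhds (S G)) := by
    intro G hG
    induction hG using Submodule.span_induction with
    | mem x hx => obtain ⟨n, rfl⟩ := hx; exact h n
    | zero => simp
    | add x y _ _ hx hy => simpa using hx.add hy
    | smul a x _ hx => simpa using hx.const_smul a
  rw [Metric.tendsto_atTop]
  intro ε hε
  have hC0 : 0 ≤ C := (norm_nonneg _).trans (hC 0)
  set K := C + ‖S‖ + 1 with hK
  have hK0 : 0 < K := by positivity
  obtain ⟨G, hG, hFG⟩ := Metric.dense_iff.1 (dense_phi hp) F (ε / (2 * K)) (by positivity)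
  obtain ⟨N0, hN0⟩ := Metric.tendsto_atTop.1 (hspan G hFG) (ε / 2) (by positivity)
  refine ⟨N0, fun N hN => ?_⟩
  have h1 := hN0 N hN
  rw [dist_eq_norm] at h1 ⊢
  have hG' : ‖F - G‖ < ε / (2 * K) := by
    have := Metric.mem_ball.1 hG
    rwa [dist_comm, dist_eq_norm] at this
  have e : D N F - S F = (D N (F - G) - S (F - G)) + (D N G - S G) := by
    simp only [map_sub]; abel
  have a1 : ‖D N (F - G)‖ ≤ C * ‖F - G‖ :=
    ((D N).le_opNorm _).trans (mul_le_mul_of_nonneg_right (hC N) (norm_nonneg _))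
  have a2 := S.le_opNorm (F - G)
  have a3 := norm_sub_le (D N (F - G)) (S (F - G))
  have a4 := norm_add_le (D N (F - G) - S (F - G)) (D N G - S G)
  have a5 : K * ‖F - G‖ < ε / 2 := by
    calc K * ‖F - G‖ < K * (ε / (2 * K)) := by gcongr
      _ = ε / 2 := by field_simp
  rw [e]
  have a6 : K * ‖F - G‖ = C * ‖F - G‖ + ‖S‖ * ‖F - G‖ + ‖F - G‖ := by rw [hK]; ring
  linarith [norm_nonneg (F - G)]

section
variable {p : ℝ≥0∞} [Fact (1 ≤ p)]

/-- modulation -/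
def UU (p : ℝ≥0∞) [Fact (1 ≤ p)] (m : ℤ) : XX p →L[ℂ] XX p :=
  mulL (fun x => fourier m x) (fourier m).continuous.aestronglyMeasurable 1
    (Eventually.of_forall fun x => (norm_fourier m x).le)

lemma norm_UU (m : ℤ) : ‖UU p m‖ ≤ 1 := norm_mulL_le _ _ _ _ zero_le_one

lemma UU_phi (m n : ℤ) : UU p m (fourierLp p n) = fourierLp p (m + n) := by
  apply Lp.ext
  filter_upwards [mulL_ae (p := p) (fun x => fourier m x)
    (fourier m).continuous.aestronglyMeasurable 1
    (Eventually.of_forall fun x => (norm_fourier m x).le) (fourierLp p n),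
    coeFn_fourierLp p n, coeFn_fourierLp p (m + n)] with x h1 h2 h3
  rw [h3, fourier_add, ← h2]
  exact h1

lemma cesC {Z : Type*} [NormedAddCommGroup Z] [NormedSpace ℂ Z] {u : ℕ → Z} {l : Z}
    (h : Tendsto u atTop (nhds l)) :
    Tendsto (fun n : ℕ => (n:ℂ)⁻¹ • ∑ i ∈ Finset.range n, u i) atTop (nhds l) := by
  refine h.cesaro_smul.congr fun N => ?_
  rw [← Complex.coe_smul]
  push_cast
  rfl

lemma PF_phi_tendsto (m : ℤ) : Tendsto (fun N => PF p N (fourierLp p m)) atTop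
    (nhds (if 0 ≤ m then fourierLp p m else 0)) := by
  have h0 : Tendsto (fun k : ℕ => mult p (Finset.Icc 0 (k:ℤ)) (fun _ => 1) (fourierLp p m)) atTop
      (nhds (if 0 ≤ m then fourierLp p m else 0)) := by
    refine tendsto_const_nhds.congr' ?_
    filter_upwards [eventually_ge_atTop m.toNat] with k hk
    rw [mult_phi]
    have : m ∈ Finset.Icc 0 (k:ℤ) ↔ 0 ≤ m := by rw [Finset.mem_Icc]; omega
    simp only [this, one_smul]
  have h1 := (cesC h0).comp (tendsto_add_atTop_nat 1)
  refine h1.congr fun N => ?_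
  simp only [Function.comp, PF, smul_apply, sum_apply]
  push_cast
  rfl

lemma riesz_le_two (h1 : 1 < p) (h2 : p ≤ 2) : ∃ C : ℝ, 0 ≤ C ∧ ∀ M, ‖SS p M‖ ≤ C := by
  have hp : p ≠ ∞ := (h2.trans_lt (by simp)).ne
  obtain ⟨C, hC, h⟩ := PF_bdd p h1 h2
  refine ⟨2 * C, by linarith, fun M => ContinuousLinearMap.opNorm_le_bound _ (by linarith) fun F => ?_⟩
  let D : ℕ → XX p →L[ℂ] XX p := fun N => (UU p (-M)).comp ((PF p N).comp (UU p M))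
    - (UU p (M + 1)).comp ((PF p N).comp (UU p (-(M + 1))))
  have hcomp : ∀ a b : ℤ, ∀ N, ‖(UU p a).comp ((PF p N).comp (UU p b))‖ ≤ C := by
    intro a b N
    calc _ ≤ ‖UU p a‖ * (‖PF p N‖ * ‖UU p b‖) :=
          (ContinuousLinearMap.opNorm_comp_le _ _).trans
            (mul_le_mul_of_nonneg_left (ContinuousLinearMap.opNorm_comp_le _ _) (norm_nonneg _))
      _ ≤ 1 * (C * 1) := by
          have := norm_UU (p := p) a
          have := norm_UU (p := p) b
          have := h N
          gcongr
      _ = C := by ring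
  have hD : ∀ N, ‖D N‖ ≤ 2 * C := fun N =>
    (norm_sub_le _ _).trans (by have := hcomp (-M) M N; have := hcomp (M+1) (-(M+1)) N; linarith)
  have hlim := strong_conv hp D (2 * C) hD (SS p M) (by
    intro n
    simp only [D, sub_apply, ContinuousLinearMap.comp_apply, UU_phi]
    have t1 := ((UU p (-M)).continuous.tendsto _).comp (PF_phi_tendsto (p := p) ((M:ℤ) + n))
    have t2 := ((UU p (M+1)).continuous.tendsto _).comp (PF_phi_tendsto (p := p) (-((M:ℤ) + 1) + n))
    have e0 := t1.sub t2
    suffices hs : SS p M (fourierLp p n) = UU p (-M) (if 0 ≤ (M:ℤ) + n then fourierLp p ((M:ℤ) + n) else 0)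
        - UU p (M+1) (if 0 ≤ -((M:ℤ) + 1) + n then fourierLp p (-((M:ℤ) + 1) + n) else 0) by
      rw [hs]; exact e0
    simp only [SS, mult_phi, Finset.mem_Icc, one_smul]
    have e1 : UU p (-M) (if 0 ≤ (M:ℤ) + n then fourierLp p ((M:ℤ) + n) else 0)
        = if 0 ≤ (M:ℤ) + n then fourierLp p n else 0 := by
      split_ifs
      · rw [UU_phi]; congr 1; ring
      · simp
    have e2 : UU p (M+1) (if 0 ≤ -((M:ℤ) + 1) + n then fourierLp p (-((M:ℤ) + 1) + n) else 0)
        = if 0 ≤ -((M:ℤ) + 1) + n then fourierLp p n else 0 := by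
      split_ifs
      · rw [UU_phi]; congr 1; ring
      · simp
    rw [e1, e2]
    split_ifs <;> first | omega | simp) F
  refine le_of_tendsto hlim.norm (Eventually.of_forall fun N => ?_)
  exact ((D N).le_opNorm F).trans (mul_le_mul_of_nonneg_right (hD N) (norm_nonneg _))

lemma norm_Lp_eq (hp : p ≠ ∞) (f : XX p) :
    ‖f‖ = (∫ x, ‖f x‖ ^ p.toReal ∂nu) ^ p.toReal⁻¹ := by
  have hp0 : p ≠ 0 := (one_pos.trans_le (Fact.out : 1 ≤ p)).ne'
  rw [Lp.norm_def, MemLp.eLpNorm_eq_integral_rpow_norm hp0 hp (Lp.memLp f), ENNReal.toReal_ofReal]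
  exact Real.rpow_nonneg (integral_nonneg fun _ => Real.rpow_nonneg (norm_nonneg _) _) _

end

lemma riesz_gt_two {p : ℝ≥0∞} [Fact (1 ≤ p)] (h1 : 2 < p) (hp : p ≠ ∞) :
    ∃ C : ℝ, 0 ≤ C ∧ ∀ M, ‖SS p M‖ ≤ C := by
  set r := p.toReal with hr
  have hr2 : 2 < r := by
    have := (ENNReal.toReal_lt_toReal (by simp) hp).2 h1
    simpa using this
  set q' : ℝ := r / (r - 1) with hq'
  have hq1 : 1 < q' := by rw [hq', lt_div_iff₀ (by linarith)]; linarith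
  have hq2 : q' ≤ 2 := by rw [hq', div_le_iff₀ (by linarith)]; linarith
  set q : ℝ≥0∞ := ENNReal.ofReal q' with hq
  have hqt : q.toReal = q' := ENNReal.toReal_ofReal (by linarith)
  have hqtop : q ≠ ∞ := ENNReal.ofReal_ne_top
  have hq1' : 1 < q := by rw [hq, ← ENNReal.ofReal_one]; exact (ENNReal.ofReal_lt_ofReal_iff (by linarith)).2 hq1
  have hq2' : q ≤ 2 := by
    rw [hq]; exact ENNReal.ofReal_le_of_le_toReal (by simpa using hq2)
  have : Fact (1 ≤ q) := ⟨hq1'.le⟩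
  obtain ⟨C, hC, h⟩ := riesz_le_two hq1' hq2'
  refine ⟨C, hC, fun M => ContinuousLinearMap.opNorm_le_bound _ hC fun F => ?_⟩
  set Ic := Finset.Icc (-(M:ℤ)) M with hIc
  set hh : C(TT, ℂ) := multC Ic (fun _ => 1) F with hhh
  have hS : SS p M F = ContinuousMap.toLp p nu ℂ hh := (toLp_multC _ _ _).symm
  set gg : C(TT, ℂ) := ⟨fun x => (starRingEnd ℂ) (hh x) * ((‖hh x‖ ^ (r - 2) : ℝ) : ℂ), by
    have : Continuous fun x => ‖hh x‖ ^ (r - 2) :=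
      hh.continuous.norm.rpow_const (fun _ => Or.inr (by linarith))
    have h2 := Complex.continuous_ofReal.comp this
    exact (Complex.continuous_conj.comp hh.continuous).mul h2⟩ with hgg
  have hgx : ∀ x, gg x = (starRingEnd ℂ) (hh x) * ((‖hh x‖ ^ (r - 2) : ℝ) : ℂ) := fun x => rfl
  set G : XX q := ContinuousMap.toLp q nu ℂ gg with hG
  set kk : C(TT, ℂ) := multC Ic (fun _ => 1) G with hkk
  have hSG : SS q M G = ContinuousMap.toLp q nu ℂ kk := (toLp_multC _ _ _).symm
  set J : ℝ := ∫ x, ‖hh x‖ ^ r ∂nu with hJ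
  have hJ0 : 0 ≤ J := integral_nonneg fun _ => Real.rpow_nonneg (norm_nonneg _) _
  -- pairing identity
  have hEG : ∀ n, EE q n G = ∫ t, fourier (-n) t * gg t ∂nu := by
    intro n
    rw [EE_apply, fourierCoeff_congr_ae (ContinuousMap.coeFn_toLp nu gg)]
    rfl
  have hEF : ∀ n, EE p n F = ∫ t, fourier (-n) t * F t ∂nu := fun n => rfl
  have id1 : ∫ x, hh x * gg x ∂nu = (J : ℂ) := by
    rw [hJ, ← integral_complex_ofReal]
    congr 1; ext x
    rw [hgx, ← mul_assoc, Complex.mul_conj, Complex.normSq_eq_norm_sq, ← Complex.ofReal_mul]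
    congr 1
    rcases eq_or_ne ‖hh x‖ 0 with h0 | h0
    · rw [h0, Real.zero_rpow (by linarith), Real.zero_rpow (by linarith)]; ring
    · have := lt_of_le_of_ne (norm_nonneg (hh x)) h0.symm
      rw [← Real.rpow_natCast, ← Real.rpow_add this]
      congr 1; push_cast; ring
  have id2 : ∫ x, hh x * gg x ∂nu = ∑ n ∈ Ic, EE p n F * EE q (-n) G := by
    simp only [hhh, multC_apply, one_mul, Finset.sum_mul]
    rw [integral_finsetSum]
    · refine Finset.sum_congr rfl fun n _ => ?_
      rw [hEG, neg_neg, ← integral_const_mul]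
      congr 1; ext x; ring
    · intro n _
      exact cont_integrableC (by fun_prop)
  have id3 : ∫ x, F x * kk x ∂nu = ∑ n ∈ Ic, EE p (-n) F * EE q n G := by
    simp only [hkk, multC_apply, one_mul, Finset.mul_sum]
    rw [integral_finsetSum]
    · refine Finset.sum_congr rfl fun n _ => ?_
      rw [hEF, neg_neg, ← integral_mul_const]
      congr 1; ext x; ring
    · intro n _
      have : Integrable (fun x => fourier n x * F x) nu := by
        refine (XX_integrable F).bdd_mul (c := 1) (fourier n).continuous.aestronglyMeasurable ?_
        filter_upwards with t
        rw [norm_fourier]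
      refine (this.const_mul (EE q n G)).congr ?_
      filter_upwards with x
      ring
  have id4 : ∑ n ∈ Ic, EE p n F * EE q (-n) G = ∑ n ∈ Ic, EE p (-n) F * EE q n G := by
    refine Finset.sum_nbij' (fun n => -n) (fun n => -n) ?_ ?_ ?_ ?_ ?_
    · intro n hn; simp only [hIc, Finset.mem_Icc] at hn ⊢; omega
    · intro n hn; simp only [hIc, Finset.mem_Icc] at hn ⊢; omega
    · intro n _; simp
    · intro n _; simp
    · intro n _; simp
  have id5 : (J : ℂ) = ∫ x, F x * kk x ∂nu := by rw [id3, ← id4, ← id2, id1]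
  have hconj : r.HolderConjugate q' := Real.HolderConjugate.conjExponent (by linarith)
  have memF : MemLp F (ENNReal.ofReal r) nu := by
    rw [hr, ENNReal.ofReal_toReal hp]; exact Lp.memLp F
  have memk : MemLp kk (ENNReal.ofReal q') nu :=
    (memLp_congr_ae (ContinuousMap.coeFn_toLp (𝕜 := ℂ) (p := q) nu kk)).1 (Lp.memLp _)
  have hold := integral_mul_norm_le_Lp_mul_Lq hconj memF memk
  have hJle : J ≤ ‖F‖ * ‖SS q M G‖ := by
    have : J = ‖(J : ℂ)‖ := by rw [Complex.norm_real, Real.norm_of_nonneg hJ0]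
    rw [this, id5, hSG, norm_toLp_eq hqtop, norm_Lp_eq hp]
    refine (norm_integral_le_integral_norm _).trans ?_
    simp only [norm_mul]
    rw [hqt]
    simpa [one_div] using hold
  have hGn : ‖G‖ = J ^ q'⁻¹ := by
    rw [hG, norm_toLp_eq hqtop, hqt, hJ]
    congr 2; ext x
    rw [hgx, norm_mul, RCLike.norm_conj, Complex.norm_real, Real.norm_of_nonneg (by positivity)]
    rcases eq_or_ne ‖hh x‖ 0 with h0 | h0
    · rw [h0, zero_mul, Real.zero_rpow (by linarith), Real.zero_rpow (by linarith)]
    · have h0' := lt_of_le_of_ne (norm_nonneg (hh x)) h0.symm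
      nth_rewrite 1 [← Real.rpow_one ‖hh x‖]
      rw [← Real.rpow_add h0', ← Real.rpow_mul h0'.le]
      congr 1
      rw [hq']
      have : r - 1 ≠ 0 := by linarith
      field_simp
      ring
  have hJ2 : J ≤ ‖F‖ * (C * J ^ q'⁻¹) := by
    refine hJle.trans ?_
    rw [← hGn]
    gcongr
    exact ((SS q M).le_opNorm G).trans (mul_le_mul_of_nonneg_right (h M) (norm_nonneg _))
  rw [hS, norm_toLp_eq hp]
  change J ^ r⁻¹ ≤ _
  rcases eq_or_ne J 0 with h0 | h0
  · rw [h0, Real.zero_rpow (by positivity)]; positivity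
  · have h0' := lt_of_le_of_ne hJ0 h0.symm
    have hsum : J ^ r⁻¹ * J ^ q'⁻¹ = J := by
      rw [← Real.rpow_add h0', hconj.inv_add_inv_eq_one, Real.rpow_one]
    have hpos : 0 < J ^ q'⁻¹ := Real.rpow_pos_of_pos h0' _
    refine le_of_mul_le_mul_right ?_ hpos
    rw [hsum]
    linarith

lemma riesz {p : ℝ≥0∞} [Fact (1 ≤ p)] (h1 : 1 < p) (hp : p ≠ ∞) :
    ∃ C : ℝ, 0 ≤ C ∧ ∀ M, ‖SS p M‖ ≤ C := by
  rcases le_or_gt p 2 with h | h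
  · exact riesz_le_two h1 h
  · exact riesz_gt_two h hp

section
variable {p : ℝ≥0∞} [Fact (1 ≤ p)]

lemma SS_phi_tendsto (m : ℤ) : Tendsto (fun N => SS p N (fourierLp p m)) atTop
    (nhds (fourierLp p m)) := by
  refine tendsto_const_nhds.congr' ?_
  filter_upwards [eventually_ge_atTop m.natAbs] with k hk
  rw [SS, mult_phi, if_pos (by rw [Finset.mem_Icc]; omega), one_smul]

/-- Cesàro means used in the statement. -/
def CC (p : ℝ≥0∞) [Fact (1 ≤ p)] (N : ℕ) : XX p →L[ℂ] XX p :=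
  (N:ℂ)⁻¹ • ∑ k ∈ Finset.Icc 1 N, SS p k

lemma SS_strong (h1 : 1 < p) (hp : p ≠ ∞) (F : XX p) :
    Tendsto (fun N => SS p N F) atTop (nhds F) := by
  obtain ⟨C, _, h⟩ := riesz h1 hp
  exact strong_conv hp _ C h (ContinuousLinearMap.id ℂ _) (fun n => SS_phi_tendsto n) F

lemma sum_Icc_one {A : Type*} [AddCommMonoid A] (a : ℕ → A) (N : ℕ) :
    ∑ k ∈ Finset.Icc 1 N, a k = ∑ k ∈ Finset.range N, a (k + 1) := by
  rw [Finset.range_eq_Ico, Finset.sum_Ico_add' a 0 N 1]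
  rfl

lemma norm_CC_le (hp : p ≠ ∞) (N : ℕ) : ‖CC p N‖ ≤ 3 := by
  rcases Nat.eq_zero_or_pos N with rfl | hN
  · simp [CC]
  have hN1 : (1:ℝ) ≤ N := by exact_mod_cast hN
  have hNc : (N:ℂ) + 1 ≠ 0 := by exact_mod_cast Nat.succ_ne_zero N
  have e : CC p N = (N:ℂ)⁻¹ • (((N:ℂ) + 1) • fejer p N - SS p 0) := by
    rw [fejer, smul_smul, mul_inv_cancel₀ hNc, one_smul, Finset.sum_range_succ', add_sub_cancel_right,
      CC, sum_Icc_one]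
  have h0 : ‖SS p 0‖ ≤ 1 := by
    have : SS p 0 = fejer p 0 := by simp [fejer]
    rw [this]; exact norm_fejer_le hp 0
  rw [e, norm_smul, norm_inv, Complex.norm_natCast]
  have h2 : ‖((N:ℂ) + 1) • fejer p N - SS p 0‖ ≤ (N + 1) * 1 + 1 := by
    refine (norm_sub_le _ _).trans (add_le_add ?_ h0)
    rw [norm_smul]
    have : ‖(N:ℂ) + 1‖ = N + 1 := by
      rw [← Nat.cast_succ, Complex.norm_natCast]; push_cast; rfl
    rw [this]
    gcongr
    exact norm_fejer_le hp N
  rw [inv_mul_le_iff₀ (by linarith)]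
  linarith

lemma CC_strong (hp : p ≠ ∞) (F : XX p) : Tendsto (fun N => CC p N F) atTop (nhds F) := by
  refine strong_conv hp _ 3 (norm_CC_le hp) (ContinuousLinearMap.id ℂ _) (fun n => ?_) F
  have h1 := cesC ((tendsto_add_atTop_iff_nat 1).2 (SS_phi_tendsto (p := p) n))
  refine h1.congr fun N => ?_
  simp only [CC, smul_apply, sum_apply, sum_Icc_one]
end

end S10

namespace S10

lemma volume_eq_nu : (volume : Measure TT) = nu := by
  simp [AddCircle.volume_eq_smul_haarAddCircle]

lemma exists_lift {p : ℝ≥0∞} [Fact (1 ≤ p)] (g : ℝ → ℂ) (hg : MemLp g p μ01) :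
    ∃ G : XX p, ∀ n, EE p n G = fc g n := by
  have h0 : MemLp g p (volume.restrict (Ioc (0:ℝ) (0 + 1))) := by
    rw [zero_add, ← restrict_Ioo_eq_restrict_Ioc]; exact hg
  have h1 : MemLp (AddCircle.liftIoc (1:ℝ) 0 g) p nu := by
    rw [← volume_eq_nu]; exact h0.memLp_liftIoc
  refine ⟨h1.toLp, fun n => ?_⟩
  rw [EE_apply, fourierCoeff_congr_ae h1.coeFn_toLp, fourierCoeff_liftIoc_eq,
    fourierCoeffOn_eq_integral, fc]
  simp only [zero_add, sub_zero, one_div, inv_one, one_smul, smul_eq_mul]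
  congr 1; ext x
  rw [fourier_coe_apply]
  congr 2
  push_cast
  ring

abbrev mk (s : ℝ) : TT := (s : TT)

lemma measurable_mk' : Measurable mk := AddCircle.measurable_mk'

lemma map_mk_le : μ11.map mk ≤ (2 : ℝ≥0∞) • nu := by
  have h1 : μ11 ≤ volume.restrict (Ioc (-1:ℝ) (-1 + 1)) + volume.restrict (Ioc (0:ℝ) (0 + 1)) := by
    rw [← Measure.restrict_union (by
      rw [Set.disjoint_left]; intro x hx hy; simp only [Set.mem_Ioc] at hx hy; linarith) measurableSet_Ioc]
    refine Measure.restrict_mono ?_ le_rfl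
    intro x hx
    simp only [Set.mem_Ioo, Set.mem_union, Set.mem_Ioc] at hx ⊢
    rcases le_or_gt x 0 with h | h
    · left; constructor <;> linarith
    · right; constructor <;> linarith
  refine (Measure.map_mono h1 measurable_mk').trans ?_
  rw [Measure.map_add _ _ measurable_mk', (AddCircle.measurePreserving_mk 1 (-1)).map_eq,
    (AddCircle.measurePreserving_mk 1 0).map_eq, volume_eq_nu, two_smul]

lemma qmp_mk : Measure.QuasiMeasurePreserving mk μ11 nu :=
  ⟨measurable_mk', (Measure.absolutelyContinuous_of_le map_mk_le).trans
    Measure.smul_absolutelyContinuous⟩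

section
variable {p : ℝ≥0∞} [Fact (1 ≤ p)]

abbrev YY (p : ℝ≥0∞) := Lp ℂ p μ11

lemma eLpNorm_pull_le (hp : p ≠ ∞) (F : XX p) :
    eLpNorm (fun s => F (mk s)) p μ11 ≤ 2 * eLpNorm F p nu := by
  have hF : AEStronglyMeasurable F (μ11.map mk) :=
    (Lp.aestronglyMeasurable F).mono_ac qmp_mk.absolutelyContinuous
  have := eLpNorm_map_measure (p := p) hF measurable_mk'.aemeasurable
  change eLpNorm (F ∘ mk) p μ11 ≤ _
  rw [← this]
  refine (eLpNorm_mono_measure _ map_mk_le).trans ?_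
  rw [eLpNorm_smul_measure_of_ne_top hp, smul_eq_mul]
  gcongr
  have hp1 : 1 ≤ p.toReal := by
    rw [← ENNReal.toReal_one]; exact (ENNReal.toReal_le_toReal (by simp) hp).2 Fact.out
  calc (2:ℝ≥0∞) ^ (1 / p).toReal ≤ 2 ^ (1:ℝ) := by
        apply ENNReal.rpow_le_rpow_of_exponent_le (by norm_num)
        rw [ENNReal.toReal_div, ENNReal.toReal_one, div_le_one (by linarith)]
        exact hp1
    _ = 2 := by simp

lemma memLp_pull (hp : p ≠ ∞) (F : XX p) : MemLp (fun s => F (mk s)) p μ11 :=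
  ⟨(Lp.aestronglyMeasurable F).comp_quasiMeasurePreserving qmp_mk,
    (eLpNorm_pull_le hp F).trans_lt (ENNReal.mul_lt_top (by simp) (Lp.eLpNorm_lt_top F))⟩

def JJ (hp : p ≠ ∞) : XX p →L[ℂ] YY p :=
  LinearMap.mkContinuous
    { toFun := fun F => (memLp_pull hp F).toLp
      map_add' := fun F G => by
        apply Lp.ext
        filter_upwards [(memLp_pull hp F).coeFn_toLp, (memLp_pull hp G).coeFn_toLp,
          (memLp_pull hp (F + G)).coeFn_toLp, qmp_mk.ae (Lp.coeFn_add F G),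
          Lp.coeFn_add (memLp_pull hp F).toLp (memLp_pull hp G).toLp]
          with x h1 h2 h3 h4 h5
        rw [h5, h3, Pi.add_apply, h1, h2, h4, Pi.add_apply]
      map_smul' := fun c F => by
        apply Lp.ext
        filter_upwards [(memLp_pull hp F).coeFn_toLp,
          (memLp_pull hp (c • F)).coeFn_toLp, qmp_mk.ae (Lp.coeFn_smul c F),
          Lp.coeFn_smul c (memLp_pull hp F).toLp]
          with x h1 h3 h4 h5
        simp only [RingHom.id_apply]
        rw [h5, h3, Pi.smul_apply, h1, h4, Pi.smul_apply] } 2 (fun F => by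
    simp only [LinearMap.coe_mk, AddHom.coe_mk]
    rw [Lp.norm_toLp, Lp.norm_def]
    have := ENNReal.toReal_mono (ENNReal.mul_ne_top (by simp) (Lp.eLpNorm_ne_top F))
      (eLpNorm_pull_le hp F)
    simpa using this)

lemma JJ_phi (hp : p ≠ ∞) (n : ℤ) :
    JJ hp (fourierLp p n) =ᵐ[μ11] fun s => cexp (2 * Real.pi * I * n * s) := by
  filter_upwards [(memLp_pull hp (fourierLp p n)).coeFn_toLp, qmp_mk.ae (coeFn_fourierLp p n)]
    with s h1 h2
  refine h1.trans (h2.trans ?_)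
  rw [fourier_coe_apply]
  simp

/-- weight function -/
def bb (k : ℕ) (s : ℝ) : ℂ := cexp (I * Real.pi * s) * ((2 * I * s) ^ k / (k.factorial : ℂ))

lemma bb_cont (k : ℕ) : Continuous (bb k) := by
  unfold bb; fun_prop

lemma ae_mu11 : ∀ᵐ s ∂μ11, |s| ≤ 1 := by
  rw [μ11, ae_restrict_iff' measurableSet_Ioo]
  filter_upwards with s hs
  exact abs_le.2 ⟨hs.1.le, hs.2.le⟩

lemma bb_le (k : ℕ) : ∀ᵐ s ∂μ11, ‖bb k s‖ ≤ 2 ^ k / (k.factorial : ℝ) := by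
  filter_upwards [ae_mu11] with s hs
  have h1 : ‖cexp (I * Real.pi * s)‖ = 1 := by
    rw [show I * Real.pi * s = ((Real.pi * s : ℝ) : ℂ) * I by push_cast; ring,
      Complex.norm_exp_ofReal_mul_I]
  rw [bb, norm_mul, h1, one_mul, norm_div, norm_pow, norm_mul, norm_mul, Complex.norm_I,
    Complex.norm_natCast, Complex.norm_real, Real.norm_eq_abs]
  gcongr
  simpa using hs

def LL (hp : p ≠ ∞) (k : ℕ) : XX p →L[ℂ] YY p :=
  (mulL (bb k) (bb_cont k).aestronglyMeasurable _ (bb_le k)).comp (JJ hp)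

lemma norm_LL_le (hp : p ≠ ∞) (k : ℕ) : ‖LL (p := p) hp k‖ ≤ 2 ^ k / (k.factorial : ℝ) * ‖JJ (p := p) hp‖ :=
  (ContinuousLinearMap.opNorm_comp_le _ _).trans
    (mul_le_mul_of_nonneg_right (norm_mulL_le _ _ _ _ (by positivity)) (norm_nonneg _))

lemma LL_phi (hp : p ≠ ∞) (k : ℕ) (n : ℤ) :
    LL hp k (fourierLp p n) =ᵐ[μ11] fun s => bb k s * cexp (2 * Real.pi * I * n * s) := by
  filter_upwards [mulL_ae (bb k) (bb_cont k).aestronglyMeasurable _ (bb_le k)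
    (JJ hp (fourierLp p n)), JJ_phi hp n] with s h1 h2
  rw [← h2]
  exact h1

lemma hasSum_ae {f : ℕ → YY p} {y : YY p} (hf : HasSum f y) (g : ℕ → ℝ → ℂ) (v : ℝ → ℂ)
    (hg : ∀ k, f k =ᵐ[μ11] g k) (hv : ∀ s, HasSum (fun k => g k s) (v s)) : y =ᵐ[μ11] v := by
  have hp0 : p ≠ 0 := (one_pos.trans_le (Fact.out : 1 ≤ p)).ne'
  have h1 := tendstoInMeasure_of_tendsto_Lp hf.tendsto_sum_nat
  obtain ⟨ns, hns, hlim⟩ := h1.exists_seq_tendsto_ae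
  have hsum : ∀ K : ℕ, (∑ k ∈ Finset.range K, f k : YY p) =ᵐ[μ11]
      fun s => ∑ k ∈ Finset.range K, g k s := by
    intro K
    induction K with
    | zero =>
      simp only [Finset.range_zero, Finset.sum_empty]
      exact Lp.coeFn_zero _ _ _
    | succ K ih =>
      simp only [Finset.sum_range_succ]
      filter_upwards [ih, hg K, Lp.coeFn_add (∑ k ∈ Finset.range K, f k) (f K)] with s a b c
      rw [c, Pi.add_apply, a, b]
  filter_upwards [hlim, ae_all_iff.2 hsum] with s h2 h3
  have h4 : Tendsto (fun i => ∑ k ∈ Finset.range (ns i), g k s) atTop (nhds (y s)) :=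
    h2.congr fun i => h3 (ns i)
  exact tendsto_nhds_unique h4 ((hv s).tendsto_sum_nat.comp hns.tendsto_atTop)

/-- the scalar term -/
def vv (lam al : ℤ → ℝ) (n : ℤ) (s : ℝ) : ℂ :=
  (al n : ℂ) * cexp (2 * I * (lam n : ℂ) * s) - cexp (I * (Real.pi * (2 * (n:ℂ) + 1) * s))

lemma vv_cont (lam al : ℤ → ℝ) (n : ℤ) : Continuous (vv lam al n) := by
  unfold vv; fun_prop

lemma vv_memLp (lam al : ℤ → ℝ) (n : ℤ) : MemLp (vv lam al n) p μ11 := by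
  have : IsFiniteMeasure μ11 := by unfold μ11; infer_instance
  refine MemLp.of_bound (vv_cont lam al n).aestronglyMeasurable (|al n| + 1) ?_
  filter_upwards with s
  unfold vv
  refine (norm_sub_le _ _).trans ?_
  rw [norm_mul]
  rw [show 2 * I * (lam n : ℂ) * s = ((2 * lam n * s : ℝ) : ℂ) * I by push_cast; ring,
      Complex.norm_exp_ofReal_mul_I,
      show I * (Real.pi * (2 * (n:ℂ) + 1) * s) = ((Real.pi * (2 * n + 1) * s : ℝ) : ℂ) * I by
        push_cast; ring,
      Complex.norm_exp_ofReal_mul_I, Complex.norm_real, mul_one, Real.norm_eq_abs]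

def VV (p : ℝ≥0∞) [Fact (1 ≤ p)] (lam al : ℤ → ℝ) (n : ℤ) : YY p := (vv_memLp lam al n).toLp

/-- coefficients -/
def aa (r c : ℂ) (k : ℕ) : ℂ := c * r ^ k - if k = 0 then 1 else 0

lemma aa_hasSum (lam al : ℤ → ℝ) (n : ℤ) (r : ℂ) (hr : (lam n : ℂ) = Real.pi * (n + 1/2) + r) (s : ℝ) :
    HasSum (fun k => aa r (al n) k * (bb k s * cexp (2 * Real.pi * I * n * s))) (vv lam al n s) := by
  have h1 : HasSum (fun k : ℕ => (2 * I * s * r) ^ k / (k.factorial : ℂ)) (cexp (2 * I * s * r)) := by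
    have := NormedSpace.expSeries_div_hasSum_exp (2 * I * s * r)
    rwa [← Complex.exp_eq_exp_ℂ] at this
  have h2 : HasSum (fun k : ℕ => if k = 0 then (1:ℂ) else 0) 1 := by
    simpa using hasSum_ite_eq (0:ℕ) (1:ℂ)
  have h3 := ((h1.mul_left (al n : ℂ)).sub h2).mul_left
    (cexp (I * Real.pi * s) * cexp (2 * Real.pi * I * n * s))
  have e1 : (fun k => aa r (al n) k * (bb k s * cexp (2 * Real.pi * I * n * s))) = fun k =>
      cexp (I * Real.pi * s) * cexp (2 * Real.pi * I * n * s) *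
        ((al n : ℂ) * ((2 * I * s * r) ^ k / (k.factorial : ℂ)) - if k = 0 then 1 else 0) := by
    ext k
    simp only [aa, bb]
    rcases eq_or_ne k 0 with rfl | hk
    · simp; ring
    · simp only [hk, if_false, sub_zero, mul_pow]
      ring
  have e2 : vv lam al n s = cexp (I * Real.pi * s) * cexp (2 * Real.pi * I * n * s) *
      ((al n : ℂ) * cexp (2 * I * s * r) - 1) := by
    simp only [vv]
    rw [hr, ← Complex.exp_add, mul_sub, mul_one, mul_left_comm (cexp _), ← Complex.exp_add]
    congr 3 <;> ring
  rw [e1, e2]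
  exact h3

lemma VV_hasSum (hp : p ≠ ∞) (lam al : ℤ → ℝ) (n : ℤ) (r : ℂ)
    (hr : (lam n : ℂ) = Real.pi * (n + 1/2) + r) :
    HasSum (fun k => aa r (al n) k • LL hp k (fourierLp p n)) (VV p lam al n) := by
  have hs : Summable (fun k => aa r (al n) k • LL hp k (fourierLp p n)) := by
    refine Summable.of_norm_bounded
      (g := fun k => (‖(al n : ℂ)‖ + 1) * ‖JJ (p := p) hp‖ * ((2 * (‖r‖ + 1)) ^ k / (k.factorial : ℝ)))
      ((Real.summable_pow_div_factorial _).mul_left _) ?_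
    intro k
    rw [norm_smul]
    have e1 : ‖aa r (al n) k‖ ≤ (‖(al n : ℂ)‖ + 1) * (‖r‖ + 1) ^ k := by
      unfold aa
      refine (norm_sub_le _ _).trans ?_
      rw [norm_mul, norm_pow, add_mul, one_mul]
      refine add_le_add ?_ ?_
      · gcongr; linarith
      · have : (1:ℝ) ≤ (‖r‖ + 1) ^ k := one_le_pow₀ (by linarith [norm_nonneg r])
        split_ifs <;> simp <;> linarith
    have e2 : ‖LL hp k (fourierLp p n)‖ ≤ 2 ^ k / (k.factorial : ℝ) * ‖JJ (p := p) hp‖ := by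
      refine ((LL hp k).le_opNorm _).trans ?_
      calc _ ≤ (2 ^ k / (k.factorial : ℝ) * ‖JJ (p := p) hp‖) * 1 :=
            mul_le_mul (norm_LL_le hp k) (norm_phi_le n) (norm_nonneg _) (by positivity)
        _ = _ := mul_one _
    refine (mul_le_mul e1 e2 (norm_nonneg _) (by positivity)).trans (le_of_eq ?_)
    rw [mul_pow]; ring
  have h := hs.hasSum
  have := hasSum_ae h (fun k s => aa r (al n) k * (bb k s * cexp (2 * Real.pi * I * n * s)))
    (vv lam al n) (by
      intro k
      filter_upwards [Lp.coeFn_smul (aa r (al n) k) (LL hp k (fourierLp p n)), LL_phi hp k n] with s h1 h2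
      rw [h1, Pi.smul_apply, h2, smul_eq_mul]) (aa_hasSum lam al n r hr)
  have e : ∑' k, aa r (al n) k • LL hp k (fourierLp p n) = VV p lam al n :=
    Lp.ext (this.trans (vv_memLp lam al n).coeFn_toLp.symm)
  rwa [e] at h

/-- the functions `F_k` -/
def FF (hp : p ≠ ∞) (R G : XX p) : ℕ → XX p
  | 0 => G
  | k + 1 => ((conv hp R (XX_integrable R)) ^ k) (R + conv hp R (XX_integrable R) G)

lemma EE_FF (hp : p ≠ ∞) (R G : XX p) (n : ℤ) (k : ℕ) :
    EE p n (FF hp R G k) = aa (EE p n R) (1 + EE p n G) k := by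
  rcases k with _ | k
  · simp [FF, aa]
  · have : ∀ Z : XX p, EE p n (((conv hp R (XX_integrable R)) ^ k) Z) = (EE p n R) ^ k * EE p n Z := by
      intro Z
      induction k with
      | zero => simp
      | succ k ih =>
        rw [pow_succ', mul_apply_eq_comp, EE_conv, ih, ← EE_apply]; ring
    rw [FF, this, map_add, EE_conv, ← EE_apply, aa]
    simp only [Nat.succ_ne_zero, if_false]
    ring

lemma norm_FF_le (hp : p ≠ ∞) (R G : XX p) : ∃ D B : ℝ, 0 ≤ D ∧ 0 ≤ B ∧
    ∀ k, ‖FF hp R G k‖ ≤ D * B ^ k := by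
  set A := conv hp R (XX_integrable R) with hA
  refine ⟨‖G‖ + ‖R + A G‖, ‖A‖ + 1, by positivity, by positivity, fun k => ?_⟩
  rcases k with _ | k
  · simp [FF]
  · rw [FF]
    have h1 : ‖A ^ k‖ ≤ ‖A‖ ^ k := by
      rcases Nat.eq_zero_or_pos k with rfl | hk
      · rw [pow_zero, pow_zero]; exact ContinuousLinearMap.norm_id_le
      · exact norm_pow_le' _ hk
    have h2 : ‖A‖ ^ k ≤ (‖A‖ + 1) ^ (k + 1) := by
      calc ‖A‖ ^ k ≤ (‖A‖ + 1) ^ k := by gcongr; linarith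
        _ ≤ _ := pow_le_pow_right₀ (by linarith [norm_nonneg A]) (by omega)
    calc ‖(A ^ k) (R + A G)‖ ≤ ‖A ^ k‖ * ‖R + A G‖ := (A ^ k).le_opNorm _
      _ ≤ (‖A‖ + 1) ^ (k + 1) * ‖R + A G‖ := by gcongr; exact h1.trans h2
      _ ≤ (‖G‖ + ‖R + A G‖) * (‖A‖ + 1) ^ (k + 1) := by
        rw [mul_comm]; gcongr; linarith [norm_nonneg G]

lemma main_limit (hp : p ≠ ∞) (R G : XX p) (T : ℕ → XX p →L[ℂ] XX p) (C : ℝ) (hC : ∀ N, ‖T N‖ ≤ C)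
    (hT : ∀ F, Tendsto (fun N => T N F) atTop (nhds F)) :
    Tendsto (fun N => ∑' k, LL hp k (T N (FF hp R G k))) atTop
      (nhds (∑' k, LL hp k (FF hp R G k))) := by
  obtain ⟨D, B, hD, hB, h⟩ := norm_FF_le hp R G
  have hC0 : 0 ≤ C := (norm_nonneg _).trans (hC 0)
  refine tendsto_tsum_of_dominated_convergence
    (bound := fun k => (‖JJ (p := p) hp‖ * C * D) * ((2 * B) ^ k / (k.factorial : ℝ)))
    ((Real.summable_pow_div_factorial _).mul_left _) ?_ ?_
  · intro k
    exact ((LL hp k).continuous.tendsto _).comp (hT _)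
  · refine Eventually.of_forall fun N k => ?_
    calc ‖LL hp k (T N (FF hp R G k))‖ ≤ ‖LL (p := p) hp k‖ * (‖T N‖ * ‖FF hp R G k‖) :=
          ((LL hp k).le_opNorm _).trans (mul_le_mul_of_nonneg_left ((T N).le_opNorm _) (norm_nonneg _))
      _ ≤ (2 ^ k / (k.factorial : ℝ) * ‖JJ (p := p) hp‖) * (C * (D * B ^ k)) := by
          have := norm_LL_le (p := p) hp k
          have := hC N
          have := h k
          gcongr
      _ = _ := by rw [mul_pow]; ring

lemma SS_hasSum (hp : p ≠ ∞) (R G : XX p) (lam al : ℤ → ℝ)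
    (hl : ∀ n : ℤ, (lam n : ℂ) = Real.pi * (n + 1/2) + EE p n R)
    (ha : ∀ n : ℤ, (al n : ℂ) = 1 + EE p n G) (N : ℕ) :
    HasSum (fun k => LL hp k (SS p N (FF hp R G k)))
      (∑ n ∈ Finset.Icc (-(N:ℤ)) N, VV p lam al n) := by
  have := hasSum_sum (s := Finset.Icc (-(N:ℤ)) N) (fun n _ => VV_hasSum hp lam al n _ (hl n))
  have e : (fun k => LL hp k (SS p N (FF hp R G k))) = fun k => ∑ n ∈ Finset.Icc (-(N:ℤ)) N,
      aa (EE p n R) (al n) k • LL hp k (fourierLp p n) := by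
    ext1 k
    rw [SS, mult_apply, map_sum]
    refine Finset.sum_congr rfl fun n _ => ?_
    rw [map_smul, one_mul, EE_FF, ha]
  rw [e]
  exact this

lemma VV_sum_ae (lam al : ℤ → ℝ) (s : Finset ℤ) :
    (∑ n ∈ s, VV p lam al n : YY p) =ᵐ[μ11] fun t => ∑ n ∈ s, vv lam al n t := by
  induction s using Finset.induction_on with
  | empty => simp only [Finset.sum_empty]; exact Lp.coeFn_zero _ _ _
  | insert a s ha ih =>
    simp only [Finset.sum_insert ha]
    filter_upwards [ih, (vv_memLp (p := p) lam al a).coeFn_toLp,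
      Lp.coeFn_add (VV p lam al a) (∑ n ∈ s, VV p lam al n)] with t h1 h2 h3
    rw [h3, Pi.add_apply, h1, ← h2]
    rfl

lemma VV_sum2_ae (lam al : ℤ → ℝ) (s : Finset ℕ) (I : ℕ → Finset ℤ) :
    (∑ k ∈ s, ∑ n ∈ I k, VV p lam al n : YY p) =ᵐ[μ11] fun t => ∑ k ∈ s, ∑ n ∈ I k, vv lam al n t := by
  induction s using Finset.induction_on with
  | empty => simp only [Finset.sum_empty]; exact Lp.coeFn_zero _ _ _
  | insert a s ha ih =>
    simp only [Finset.sum_insert ha]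
    filter_upwards [ih, VV_sum_ae (p := p) lam al (I a),
      Lp.coeFn_add (∑ n ∈ I a, VV p lam al n) (∑ k ∈ s, ∑ n ∈ I k, VV p lam al n)] with t h1 h2 h3
    rw [h3, Pi.add_apply, h1, ← h2]

lemma tendsto_eLpNorm {Z : ℕ → YY p} {y : YY p} (h : Tendsto Z atTop (nhds y)) (z : ℕ → ℝ → ℂ)
    (hz : ∀ N, Z N =ᵐ[μ11] z N) :
    Tendsto (fun N => eLpNorm (fun s => z N s - y s) p μ11) atTop (nhds 0) := by
  have := (Lp.tendsto_Lp_iff_tendsto_eLpNorm' Z y).1 h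
  refine this.congr fun N => eLpNorm_congr_ae ?_
  filter_upwards [hz N] with s hs
  rw [Pi.sub_apply, hs]

lemma scalar_main (hp : p ≠ ∞) (lam al : ℤ → ℝ) (hla : LamAsymp p lam) (hal : AlAsymp p al) :
    ∃ y : YY p, (1 < p → Tendsto (fun N : ℕ => eLpNorm (fun s : ℝ =>
      (∑ n ∈ Finset.Icc (-(N:ℤ)) (N:ℤ), vv lam al n s) - y s) p μ11) atTop (nhds 0)) ∧
    Tendsto (fun N : ℕ => eLpNorm (fun s : ℝ =>
      ((N : ℂ)⁻¹ * ∑ k ∈ Finset.Icc 1 N, ∑ n ∈ Finset.Icc (-(k:ℤ)) (k:ℤ), vv lam al n s) - y s) p μ11)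
      atTop (nhds 0) := by
  obtain ⟨f, hf, hl⟩ := hla
  obtain ⟨g, hg, ha⟩ := hal
  obtain ⟨R, hR⟩ := exists_lift f hf
  obtain ⟨G, hG⟩ := exists_lift g hg
  simp only [← hR] at hl
  simp only [← hG] at ha
  refine ⟨∑' k, LL hp k (FF hp R G k), fun h1 => ?_, ?_⟩
  · obtain ⟨C, _, hC⟩ := riesz h1 hp
    have h := main_limit hp R G (SS p) C hC (SS_strong h1 hp)
    refine tendsto_eLpNorm h _ fun N => ?_
    rw [(SS_hasSum hp R G lam al hl ha N).tsum_eq]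
    exact VV_sum_ae lam al _
  · have h := main_limit hp R G (CC p) 3 (norm_CC_le hp) (CC_strong hp)
    refine tendsto_eLpNorm h _ fun N => ?_
    have hs := (hasSum_sum (s := Finset.Icc 1 N)
      (fun j _ => SS_hasSum hp R G lam al hl ha j)).const_smul ((N:ℂ)⁻¹)
    have e : (fun k => LL hp k (CC p N (FF hp R G k))) = fun k => (N:ℂ)⁻¹ • ∑ j ∈ Finset.Icc 1 N,
        LL hp k (SS p j (FF hp R G k)) := by
      ext1 k
      simp only [CC, smul_apply, sum_apply, map_smul, map_sum]
    rw [e, hs.tsum_eq]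
    filter_upwards [Lp.coeFn_smul ((N:ℂ)⁻¹) (∑ k ∈ Finset.Icc 1 N,
      ∑ n ∈ Finset.Icc (-(k:ℤ)) (k:ℤ), VV p lam al n),
      VV_sum2_ae (p := p) lam al (Finset.Icc 1 N) (fun k => Finset.Icc (-(k:ℤ)) (k:ℤ))] with s h1 h2
    rw [h1, Pi.smul_apply, h2, smul_eq_mul]

end
end S10

namespace S10

def PP : M2 := !![1/2, I/2; -(I/2), 1/2]
def QQ : M2 := !![1/2, -(I/2); I/2, 1/2]

lemma expB_eq (τ : ℂ) : expB τ = cexp (τ * I) • PP + cexp (-τ * I) • QQ := by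
  ext i j
  fin_cases i <;> fin_cases j <;> simp [expB, PP, QQ, Complex.cos, Complex.sin] <;> ring

lemma term_eq (lam al : ℤ → ℝ) (n : ℤ) (s : ℝ) :
    (al n : ℂ) • expB (2 * (lam n : ℂ) * (s : ℂ)) - expB (Real.pi * (2 * (n : ℂ) + 1) * (s : ℂ))
      = vv lam al n s • PP + vv lam al n (-s) • QQ := by
  rw [expB_eq, expB_eq]
  simp only [vv, sub_smul, smul_add, smul_smul]
  have e1 : 2 * (lam n : ℂ) * (s : ℂ) * I = 2 * I * (lam n : ℂ) * s := by ring
  have e2 : -(2 * (lam n : ℂ) * (s : ℂ)) * I = 2 * I * (lam n : ℂ) * ((-s : ℝ) : ℂ) := by push_cast; ring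
  have e3 : Real.pi * (2 * (n : ℂ) + 1) * (s : ℂ) * I = I * (Real.pi * (2 * (n:ℂ) + 1) * s) := by ring
  have e4 : -(Real.pi * (2 * (n : ℂ) + 1) * (s : ℂ)) * I
      = I * (Real.pi * (2 * (n:ℂ) + 1) * ((-s : ℝ) : ℂ)) := by push_cast; ring
  rw [e1, e2, e3, e4]
  abel

lemma mp_neg : MeasurePreserving (fun s : ℝ => -s) μ11 μ11 := by
  have h := (Measure.measurePreserving_neg (volume : Measure ℝ)).restrict_preimage
    (s := Ioo (-1:ℝ) 1) measurableSet_Ioo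
  have e : (Neg.neg ⁻¹' Ioo (-1:ℝ) 1) = Ioo (-1:ℝ) 1 := by
    simp
  rw [e] at h
  exact h

section
variable {Z : Type*} [NormedAddCommGroup Z] [NormedSpace ℂ Z]

lemma eLpNorm_smul_le' (p : ℝ≥0∞) (w : ℝ → ℂ) (A : Z) :
    eLpNorm (fun s => w s • A) p μ11 ≤ ‖A‖ₑ * eLpNorm w p μ11 := by
  have := eLpNorm_le_nnreal_smul_eLpNorm_of_ae_le_mul (f := fun s => w s • A) (g := w) (c := ‖A‖₊)
    (μ := μ11) (Eventually.of_forall fun s => by rw [nnnorm_smul, mul_comm]) p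
  rwa [ENNReal.smul_def, smul_eq_mul] at this

lemma gen_bound (A B : Z) {p : ℝ≥0∞} (hp : 1 ≤ p) (w : ℝ → ℂ) (hm : AEStronglyMeasurable w μ11) :
    eLpNorm (fun s => w s • A + w (-s) • B) p μ11 ≤ (‖A‖ₑ + ‖B‖ₑ) * eLpNorm w p μ11 := by
  have hm' : AEStronglyMeasurable (fun s => w (-s)) μ11 := hm.comp_measurePreserving mp_neg
  have hn : eLpNorm (fun s => w (-s)) p μ11 = eLpNorm w p μ11 :=
    eLpNorm_comp_measurePreserving hm mp_neg
  refine (eLpNorm_add_le (f := fun s => w s • A) (g := fun s => w (-s) • B)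
    (hm.smul_const A) (hm'.smul_const B) hp).trans ?_
  rw [add_mul]
  refine add_le_add (eLpNorm_smul_le' _ _ _) ?_
  rw [← hn]
  exact eLpNorm_smul_le' _ _ _

lemma gen_tendsto (A B : Z) {p : ℝ≥0∞} (hp : 1 ≤ p) (y : ℝ → ℂ) (hy : AEStronglyMeasurable y μ11)
    (u : ℕ → ℝ → ℂ) (hu : ∀ N, Continuous (u N))
    (h : Tendsto (fun N => eLpNorm (fun s => u N s - y s) p μ11) atTop (nhds 0)) :
    Tendsto (fun N => eLpNorm (fun s => (u N s • A + u N (-s) • B)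
      - (y s • A + y (-s) • B)) p μ11) atTop (nhds 0) := by
  have hlim : Tendsto (fun N => (‖A‖ₑ + ‖B‖ₑ) * eLpNorm (fun s => u N s - y s) p μ11) atTop (nhds 0) := by
    have := ENNReal.Tendsto.const_mul (a := ‖A‖ₑ + ‖B‖ₑ) h (Or.inr (by simp))
    rwa [mul_zero] at this
  refine tendsto_of_tendsto_of_tendsto_of_le_of_le tendsto_const_nhds hlim (fun _ => zero_le) ?_
  intro N
  have e : (fun s => (u N s • A + u N (-s) • B) - (y s • A + y (-s) • B))
      = fun s => (u N s - y s) • A + (u N (-s) - y (-s)) • B := by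
    ext1 s
    rw [sub_smul, sub_smul]
    abel
  simp only [e]
  exact gen_bound A B hp (fun s => u N s - y s) ((hu N).aestronglyMeasurable.sub hy)

end

lemma mat_tendsto {p : ℝ≥0∞} [Fact (1 ≤ p)] (y : YY p) (u : ℕ → ℝ → ℂ) (hu : ∀ N, Continuous (u N))
    (h : Tendsto (fun N => eLpNorm (fun s => u N s - y s) p μ11) atTop (nhds 0)) :
    Tendsto (fun N => eLpNorm (fun s => (u N s • PP + u N (-s) • QQ)
      - (y s • PP + y (-s) • QQ)) p μ11) atTop (nhds 0) :=
  gen_tendsto PP QQ Fact.out y (Lp.aestronglyMeasurable y) u hu h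

lemma mat_memLp {p : ℝ≥0∞} [Fact (1 ≤ p)] (y : YY p) :
    MemLp (fun s => y s • PP + y (-s) • QQ) p μ11 := by
  have h1 : ∀ (w : ℝ → ℂ) (A : M2), MemLp w p μ11 → MemLp (fun s => w s • A) p μ11 := by
    intro w A hw
    refine hw.of_le_mul (c := ‖A‖) (hw.1.smul_const A) (Eventually.of_forall fun s => ?_)
    rw [norm_smul, mul_comm]
  exact (h1 _ PP (Lp.memLp y)).add (h1 _ QQ ((Lp.memLp y).comp_measurePreserving mp_neg))

end S10

/-- Under the asymptotics `λ_n = π(n+1/2) + e_n(f)`, `α_n = 1 + e_n(g)`,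
the partial sums `S_N(s) = Σ_{n=-N}^{N} (α_n e^{-2λ_n sB} - e^{-π(2n+1) sB})` converge in
`L_p((-1,1),M₂)` for `p > 1`, and their Cesàro means converge in `L₁` for `p = 1`. -/
theorem statement10 (p : ℝ≥0∞) (hp : 1 ≤ p) (hp' : p ≠ ∞)
    (lam al : ℤ → ℝ) (hla : LamAsymp p lam) (hal : AlAsymp p al) :
    ∃ H : ℝ → M2, IsHSum p lam al H := by
  have : Fact (1 ≤ p) := ⟨hp⟩
  obtain ⟨y, h1, h2⟩ := S10.scalar_main hp' lam al hla hal
  refine ⟨fun s => y s • S10.PP + y (-s) • S10.QQ, S10.mat_memLp y, fun h => ?_, fun h => ?_⟩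
  · have := S10.mat_tendsto y _ (fun N => by
      exact continuous_finsetSum _ fun n _ => S10.vv_cont lam al n) (h1 h)
    refine this.congr fun N => ?_
    simp only [S10.term_eq, Finset.sum_add_distrib, Finset.sum_smul]
  · have := S10.mat_tendsto y _ (fun N => by
      exact continuous_const.mul (continuous_finsetSum _ fun k _ =>
        continuous_finsetSum _ fun n _ => S10.vv_cont lam al n)) h2
    subst h
    refine this.congr fun N => ?_
    simp only [S10.term_eq, Finset.sum_add_distrib, Finset.sum_smul, mul_smul, smul_add]
end
end

section
/- Let p ∈ [1,∞) and let (λ_n)_{n∈ℤ} be a strictly increasing sequence of real numbers with λ_n = π(n+1/2) + e_n(g) for some g ∈ L_p(0,1). Then the system (e^{iλ_n x})_{n∈ℤ} forms a Riesz basis of L₂(−1,1): the linear map T : ℓ²(ℤ) → L₂(−1,1) defined by T((a_n)) = Σ_{n∈ℤ} a_n e^{iλ_n x} is a well-defined, bounded, bijective linear operator with bounded inverse. -/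
open MeasureTheory Complex Filter Set
open scoped Matrix.Norms.L2Operator ENNReal

noncomputable section

abbrev HH := Lp ℂ 2 μ11
abbrev l2Z := lp (fun _ : ℤ => ℂ) 2

instance finite_mu11 : IsFiniteMeasure μ11 := by
  unfold μ11; infer_instance

lemma ae_mem11 : ∀ᵐ x ∂μ11, x ∈ Set.Ioo (-1:ℝ) 1 :=
  ae_restrict_mem measurableSet_Ioo

lemma memLp11 (f : C(ℝ, ℂ)) : MemLp f 2 μ11 := by
  obtain ⟨C, hC⟩ := (isCompact_Icc (a := (-1:ℝ)) (b := 1)).exists_bound_of_continuousOn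
    f.continuous.continuousOn
  refine MemLp.of_bound f.continuous.aestronglyMeasurable C ?_
  filter_upwards [ae_mem11] with x hx using hC x (Ioo_subset_Icc_self hx)

def LL : C(ℝ, ℂ) →ₗ[ℂ] HH where
  toFun f := (memLp11 f).toLp f
  map_add' _ _ := rfl
  map_smul' _ _ := rfl

lemma LL_coe (f : C(ℝ, ℂ)) : LL f =ᵐ[μ11] f := (memLp11 f).coeFn_toLp

lemma LL_norm_le (f g : C(ℝ, ℂ)) (c : ℝ)
    (h : ∀ x ∈ Set.Ioo (-1:ℝ) 1, ‖f x‖ ≤ c * ‖g x‖) : ‖LL f‖ ≤ c * ‖LL g‖ := by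
  apply Lp.norm_le_mul_norm_of_ae_le_mul
  filter_upwards [LL_coe f, LL_coe g, ae_mem11] with x h1 h2 h3
  rw [h1, h2]; exact h x h3

def exf (l : ℝ) : C(ℝ, ℂ) := ⟨fun x => Complex.exp (Complex.I * (l : ℂ) * (x : ℂ)), by fun_prop⟩

lemma exf_apply (l x : ℝ) : exf l x = Complex.exp (Complex.I * (l : ℂ) * (x : ℂ)) := rfl

lemma exf_norm (l x : ℝ) : ‖exf l x‖ = 1 := by
  rw [exf_apply, show Complex.I * (l : ℂ) * (x : ℂ) = ((l * x : ℝ) : ℂ) * Complex.I by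
    push_cast; ring]
  exact Complex.norm_exp_ofReal_mul_I _

def ev (l : ℝ) : HH := LL (exf l)

lemma integral11 (f : ℝ → ℂ) : ∫ x, f x ∂μ11 = ∫ x in (-1:ℝ)..1, f x := by
  unfold μ11
  rw [intervalIntegral.integral_of_le (by norm_num), integral_Ioc_eq_integral_Ioo]

lemma inner_LL (w : HH) (f : C(ℝ, ℂ)) :
    inner ℂ w (LL f) = ∫ x, star (w x) * f x ∂μ11 := by
  rw [L2.inner_def]
  apply integral_congr_ae
  filter_upwards [LL_coe f] with x hx
  rw [hx]; simp [mul_comm]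

lemma inner_ev_ev (a b : ℝ) :
    inner ℂ (ev a) (ev b) = ∫ x in (-1:ℝ)..1, Complex.exp ((Complex.I * (b - a : ℂ)) * (x : ℂ)) := by
  rw [ev, ev, inner_LL, ← integral11]
  apply integral_congr_ae
  filter_upwards [LL_coe (exf a)] with x hx
  rw [hx]
  simp only [exf_apply]
  have : star (Complex.exp (Complex.I * (a : ℂ) * (x : ℂ))) =
      Complex.exp (- (Complex.I * (a : ℂ) * (x : ℂ))) := by
    rw [show star (Complex.exp (Complex.I * (a : ℂ) * (x : ℂ))) =
      (starRingEnd ℂ) (Complex.exp (Complex.I * (a : ℂ) * (x : ℂ))) from rfl, ← Complex.exp_conj]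
    congr 1; simp
  rw [this, ← Complex.exp_add]; congr 1; ring

def mu0 (n : ℤ) : ℝ := Real.pi * (n + 1/2)

lemma inner_ev_self (a : ℝ) : inner ℂ (ev a) (ev a) = 2 := by
  rw [inner_ev_ev]; norm_num

lemma norm_ev (a : ℝ) : ‖ev a‖ = √2 := by
  have h := inner_self_eq_norm_sq_to_K (𝕜 := ℂ) (ev a)
  rw [inner_ev_self] at h
  have h2 : ‖ev a‖^2 = 2 := by
    have : ((‖ev a‖^2 : ℝ) : ℂ) = ((2:ℝ):ℂ) := by push_cast; exact h.symm
    exact_mod_cast this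
  rw [← h2, Real.sqrt_sq (norm_nonneg _)]

lemma inner_mu0 {m n : ℤ} (h : m ≠ n) : inner ℂ (ev (mu0 m)) (ev (mu0 n)) = 0 := by
  have hne : ((n:ℂ) - m) ≠ 0 := by
    rw [sub_ne_zero]; exact_mod_cast h.symm
  have hpi : (Real.pi : ℂ) ≠ 0 := by exact_mod_cast Real.pi_ne_zero
  rw [inner_ev_ev]
  have hc : Complex.I * ((mu0 n : ℂ) - mu0 m) = Complex.I * (Real.pi * ((n:ℂ) - m)) := by
    unfold mu0; push_cast; ring
  rw [hc, integral_exp_mul_complex (by simp [hne, hpi])]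
  rw [div_eq_zero_iff]; left
  rw [sub_eq_zero, Complex.exp_eq_exp_iff_exists_int]
  exact ⟨n - m, by push_cast; ring⟩

lemma complete_mu0 (f : HH) (h : ∀ n, inner ℂ (ev (mu0 n)) f = 0) : f = 0 := by
  set g : ℝ → ℂ := fun x => Complex.exp (-(Complex.I * (Real.pi / 2 : ℂ) * x)) * f x with hg
  have hgn : ∀ x, ‖g x‖ = ‖f x‖ := by
    intro x
    rw [hg]; simp only [norm_mul]
    rw [show -(Complex.I * (Real.pi / 2 : ℂ) * x) = ((-(Real.pi / 2 * x) : ℝ) : ℂ) * Complex.I by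
      push_cast; ring, Complex.norm_exp_ofReal_mul_I, one_mul]
  have hm : MemLp g 2 μ11 := by
    refine (Lp.memLp f).of_le ?_ (ae_of_all _ fun x => (hgn x).le)
    exact (Continuous.aestronglyMeasurable (by fun_prop)).mul (Lp.aestronglyMeasurable f)
  have hrw : volume.restrict (Ioc (-1:ℝ) 1) = μ11 := by
    unfold μ11; exact Measure.restrict_congr_set Ioo_ae_eq_Ioc.symm
  have hab : (-1:ℝ) < 1 := by norm_num
  have hs := hasSum_sq_fourierCoeffOn (f := g) hab (by rw [hrw]; exact hm)
  have hz : ∀ n, fourierCoeffOn hab g n = 0 := by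
    intro n
    rw [fourierCoeffOn_eq_integral, ← integral11]
    have h1 := h n
    rw [← inner_conj_symm, ev, inner_LL] at h1
    have h2 : ∫ x, star (f x) * exf (mu0 n) x ∂μ11 = 0 := by simpa using h1
    have h3 : ∫ x, (starRingEnd ℂ) (star (f x) * exf (mu0 n) x) ∂μ11 = 0 := by
      rw [integral_conj, h2]; simp
    rw [smul_eq_zero]; right
    rw [← h3]
    congr 1; ext x
    rw [fourier_coe_apply, smul_eq_mul, hg, exf_apply]
    simp only [map_mul, ← Complex.exp_conj]
    simp only [Complex.star_def, Complex.conj_conj, Complex.conj_I, Complex.conj_ofReal]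
    rw [← mul_assoc, ← Complex.exp_add, mul_comm]
    congr 2
    unfold mu0; push_cast; ring
  simp only [hz] at hs
  have h0 := hs.unique (a₂ := 0) (by simp)
  have h4 : ∫ x in (-1:ℝ)..1, ‖g x‖^2 = 0 := by
    simpa using h0
  have h5 : ∫ x, ‖f x‖^2 ∂μ11 = 0 := by
    rw [← h4, intervalIntegral.integral_of_le hab.le, hrw]
    simp only [hgn]
  have h6 : inner ℂ f f = 0 := by
    rw [L2.inner_def]
    have : ∀ x, inner ℂ (f x) (f x) = ((‖f x‖^2 : ℝ) : ℂ) := by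
      intro x; rw [inner_self_eq_norm_sq_to_K]; push_cast; rfl
    simp only [this]
    rw [integral_complex_ofReal, h5]; simp
  exact inner_self_eq_zero.mp h6

def RB (nu : ℤ → ℝ) : Prop :=
  ∃ T : l2Z ≃L[ℂ] HH, ∀ n, T (lp.single 2 n (1:ℂ)) = ev (nu n)

lemma base_iso : ∃ T : l2Z ≃L[ℂ] HH, (∀ n, T (lp.single 2 n (1:ℂ)) = ev (mu0 n)) ∧
    ∀ a, ‖T a‖ = √2 * ‖a‖ := by
  have s2 : (√2 : ℝ) ≠ 0 := by positivity
  have s2' : ((√2 : ℝ) : ℂ) ≠ 0 := by exact_mod_cast s2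
  set v : ℤ → HH := fun n => ((√2 : ℝ) : ℂ)⁻¹ • ev (mu0 n) with hv
  have ho : Orthonormal ℂ v := by
    constructor
    · intro n
      rw [hv]; simp only
      rw [norm_smul, norm_ev, norm_inv, Complex.norm_real, Real.norm_of_nonneg (by positivity)]
      exact inv_mul_cancel₀ s2
    · intro m n hmn
      rw [hv]; simp only
      rw [inner_smul_left, inner_smul_right, inner_mu0 hmn]; simp
  have hc : (Submodule.span ℂ (Set.range v))ᗮ = ⊥ := by
    rw [Submodule.eq_bot_iff]
    intro f hf
    apply complete_mu0
    intro n
    have := (Submodule.mem_orthogonal _ f).1 hf (v n) (Submodule.subset_span ⟨n, rfl⟩)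
    rw [hv] at this; simp only at this
    rw [inner_smul_left] at this
    rcases mul_eq_zero.1 this with h | h
    · simp at h
    · exact h
  let b := HilbertBasis.mkOfOrthogonalEqBot ho hc
  have hb : ⇑b = v := HilbertBasis.coe_mkOfOrthogonalEqBot ho hc
  let S : HH ≃L[ℂ] HH := ContinuousLinearEquiv.smulLeft (Units.mk0 _ s2')
  refine ⟨b.repr.symm.toContinuousLinearEquiv.trans S, ?_, ?_⟩
  · intro n
    have h1 : b.repr.symm (lp.single 2 n (1:ℂ)) = v n := by
      rw [← hb]; exact b.repr_symm_single n
    change ((√2 : ℝ) : ℂ) • (b.repr.symm (lp.single 2 n (1:ℂ))) = _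
    rw [h1, hv]; simp only
    rw [smul_smul, mul_inv_cancel₀ s2', one_smul]
  · intro a
    change ‖((√2 : ℝ) : ℂ) • (b.repr.symm a)‖ = _
    rw [norm_smul, LinearIsometryEquiv.norm_map, Complex.norm_real,
      Real.norm_of_nonneg (by positivity)]

lemma bessel_op (w : ℤ → HH) (C : ℝ) (hC : 0 ≤ C)
    (h : ∀ (s : Finset ℤ) (a : ℤ → ℂ),
      ‖∑ n ∈ s, a n • w n‖ ≤ C * ‖∑ n ∈ s, (lp.single 2 n (a n) : l2Z)‖) :
    ∃ K : l2Z →L[ℂ] HH, (∀ n, K (lp.single 2 n (1:ℂ)) = w n) ∧ ∀ a, ‖K a‖ ≤ C * ‖a‖ := by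
  have hs : ∀ a : l2Z, HasSum (fun n => (lp.single 2 n (a n) : l2Z)) a := fun a =>
    lp.hasSum_single (by simp) a
  have hsum : ∀ a : l2Z, Summable (fun n => a n • w n) := by
    intro a
    rw [summable_iff_vanishing_norm]
    intro ε hε
    obtain ⟨s, hs'⟩ := summable_iff_vanishing_norm.1 (hs a).summable (ε / (C + 1)) (by positivity)
    refine ⟨s, fun t ht => ?_⟩
    have h1 := hs' t ht
    rw [lt_div_iff₀ (by positivity)] at h1
    have h2 := h t a
    have h3 := norm_nonneg (∑ n ∈ t, (lp.single 2 n (a n) : l2Z))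
    nlinarith
  have hbd : ∀ a : l2Z, ‖∑' n, a n • w n‖ ≤ C * ‖a‖ := by
    intro a
    have h1 : Tendsto (fun s : Finset ℤ => ‖∑ n ∈ s, a n • w n‖) atTop (nhds ‖∑' n, a n • w n‖) :=
      (hsum a).hasSum.norm
    have h2 : Tendsto (fun s : Finset ℤ => C * ‖∑ n ∈ s, (lp.single 2 n (a n) : l2Z)‖) atTop
      (nhds (C * ‖a‖)) := Tendsto.const_mul C (hs a).norm
    exact le_of_tendsto_of_tendsto' h1 h2 fun s => h s a
  let K0 : l2Z →ₗ[ℂ] HH :=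
    { toFun := fun a => ∑' n, a n • w n
      map_add' := by
        intro a b
        rw [← (hsum a).tsum_add (hsum b)]
        congr 1; ext1 n
        rw [← add_smul]; rfl
      map_smul' := by
        intro c a
        rw [RingHom.id_apply, ← (hsum a).tsum_const_smul c]
        congr 1; ext1 n
        rw [smul_smul]; rfl }
  refine ⟨K0.mkContinuous C hbd, ?_, hbd⟩
  intro n
  change ∑' m, (lp.single 2 n (1:ℂ) : l2Z) m • w m = w n
  rw [tsum_eq_single n]
  · rw [lp.single_apply_self, one_smul]
  · intro m hm
    rw [lp.single_apply_ne _ _ _ hm, zero_smul]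

lemma sum_single_apply (s : Finset ℤ) (a : ℤ → ℂ) (m : ℤ) :
    (∑ n ∈ s, (lp.single 2 n (a n) : l2Z)) m = if m ∈ s then a m else 0 := by
  rw [lp.coeFn_sum, Finset.sum_apply]
  simp only [lp.single_apply, Pi.single_apply]
  simp

lemma sum_single_mono (s : Finset ℤ) (a b : ℤ → ℂ) (c : ℝ) (hc : 0 ≤ c)
    (h : ∀ n, ‖b n‖ ≤ c * ‖a n‖) :
    ‖∑ n ∈ s, (lp.single 2 n (b n) : l2Z)‖ ≤ c * ‖∑ n ∈ s, (lp.single 2 n (a n) : l2Z)‖ := by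
  have h1 : ‖∑ n ∈ s, (lp.single 2 n (b n) : l2Z)‖ ≤
      ‖(c : ℂ) • ∑ n ∈ s, (lp.single 2 n (a n) : l2Z)‖ := by
    apply lp.norm_mono (by simp)
    intro m
    rw [lp.coeFn_smul, Pi.smul_apply, sum_single_apply, sum_single_apply]
    split_ifs
    · rw [norm_smul, Complex.norm_real, Real.norm_of_nonneg hc]; exact h m
    · simp
  refine h1.trans ?_
  rw [norm_smul, Complex.norm_real, Real.norm_of_nonneg hc]

lemma exp_rem (z : ℂ) (hz : ‖z‖ ≤ 1/4) (K : ℕ) :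
    ‖Complex.exp z - ∑ k ∈ Finset.range (K+1), z ^ k / (k.factorial : ℂ)‖ ≤ 2 * (1/4) ^ (K+1) := by
  refine (Complex.exp_bound (by linarith) (Nat.succ_pos K)).trans ?_
  rw [mul_comm (2:ℝ)]
  have hf : (1:ℝ) ≤ ((K+1).factorial : ℝ) := by exact_mod_cast Nat.one_le_iff_ne_zero.2 (Nat.factorial_ne_zero _)
  gcongr
  rw [← div_eq_mul_inv, div_le_iff₀ (by positivity)]
  push_cast
  have hK : (0:ℝ) ≤ K := Nat.cast_nonneg K
  nlinarith

def xpow (k : ℕ) : C(ℝ, ℂ) := ⟨fun x => (x : ℂ) ^ k, by fun_prop⟩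

lemma perturb_bound (T0 : l2Z ≃L[ℂ] HH) (hT0 : ∀ n, T0 (lp.single 2 n (1:ℂ)) = ev (mu0 n))
    (hT0n : ∀ a, ‖T0 a‖ = √2 * ‖a‖) (nu : ℤ → ℝ) (hnu : ∀ n, |nu n - mu0 n| ≤ 1/4)
    (s : Finset ℤ) (a : ℤ → ℂ) :
    ‖∑ n ∈ s, a n • (ev (nu n) - ev (mu0 n))‖ ≤
      √2 / 3 * ‖∑ n ∈ s, (lp.single 2 n (a n) : l2Z)‖ := by
  set A := ‖∑ n ∈ s, (lp.single 2 n (a n) : l2Z)‖ with hA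
  set d : ℤ → ℂ := fun n => Complex.I * ((nu n - mu0 n : ℝ) : ℂ) with hd
  have hdn : ∀ n, ‖d n‖ ≤ 1/4 := by
    intro n; rw [hd]; simp only [norm_mul, Complex.norm_I, one_mul, Complex.norm_real]
    exact hnu n
  have hsumT : ∀ b : ℤ → ℂ, ‖∑ n ∈ s, b n • ev (mu0 n)‖ =
      √2 * ‖∑ n ∈ s, (lp.single 2 n (b n) : l2Z)‖ := by
    intro b
    rw [← hT0n, map_sum]
    congr 2; ext1 n
    rw [← hT0, ← map_smul, ← lp.single_smul]; simp
  set f : ℕ → C(ℝ, ℂ) := fun k => ∑ n ∈ s, (a n * (d n ^ k / (k.factorial : ℂ))) • exf (mu0 n) with hf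
  set q : ℕ → C(ℝ, ℂ) := fun k => xpow k * f k with hq
  have hqn : ∀ k, ‖LL (q k)‖ ≤ (1/4)^k * (√2 * A) := by
    intro k
    have h1 : ‖LL (q k)‖ ≤ 1 * ‖LL (f k)‖ := by
      apply LL_norm_le
      intro x hx
      rw [hq]; simp only [ContinuousMap.mul_apply, norm_mul]
      gcongr
      change ‖(x:ℂ)^k‖ ≤ 1
      rw [norm_pow, Complex.norm_real]
      exact pow_le_one₀ (norm_nonneg _) (abs_le.2 ⟨hx.1.le, hx.2.le⟩)
    have h2 : LL (f k) = ∑ n ∈ s, (a n * (d n ^ k / (k.factorial : ℂ))) • ev (mu0 n) := by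
      rw [hf]; simp only [map_sum, map_smul]; rfl
    rw [one_mul, h2, hsumT] at h1
    refine h1.trans ?_
    have h3 := sum_single_mono s a (fun n => a n * (d n ^ k / (k.factorial : ℂ))) ((1/4)^k)
      (by positivity) (by
        intro n
        rw [norm_mul, mul_comm]
        gcongr
        rw [norm_div, norm_pow]
        have : (1:ℝ) ≤ ‖(k.factorial : ℂ)‖ := by
          rw [Complex.norm_natCast]
          exact_mod_cast Nat.one_le_iff_ne_zero.2 (Nat.factorial_ne_zero _)
        refine (div_le_self (by positivity) this).trans ?_
        gcongr
        exact hdn n)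
    calc _ ≤ √2 * ((1/4)^k * A) := by gcongr
      _ = _ := by ring
  set h : C(ℝ, ℂ) := ∑ n ∈ s, a n • (exf (nu n) - exf (mu0 n)) with hh
  have hLh : LL h = ∑ n ∈ s, a n • (ev (nu n) - ev (mu0 n)) := by
    rw [hh]; simp only [map_sum, map_smul, map_sub]; rfl
  rw [← hLh]
  set B := ∑ n ∈ s, ‖a n‖ with hB
  have hB0 : 0 ≤ B := Finset.sum_nonneg fun _ _ => norm_nonneg _
  have hrem : ∀ K : ℕ, ‖LL (h - ∑ k ∈ Finset.range K, q (k+1))‖ ≤ B * (2 * (1/4)^(K+1)) * √2 := by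
    intro K
    rw [← norm_ev 0]
    apply LL_norm_le
    intro x hx
    rw [exf_norm, mul_one]
    have hval : (h - ∑ k ∈ Finset.range K, q (k+1)) x = ∑ n ∈ s, a n * (exf (mu0 n) x *
        (Complex.exp (d n * x) - ∑ k ∈ Finset.range (K+1), (d n * x)^k / (k.factorial : ℂ))) := by
      have e1 : ∀ k, q k x = ∑ n ∈ s, a n * (exf (mu0 n) x * ((d n * x)^k / (k.factorial : ℂ))) := by
        intro k
        rw [hq, hf]
        simp only [ContinuousMap.mul_apply, ContinuousMap.sum_apply, ContinuousMap.smul_apply, smul_eq_mul, Finset.mul_sum]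
        apply Finset.sum_congr rfl
        intro n _
        change (x:ℂ)^k * _ = _
        rw [mul_pow]; ring
      rw [ContinuousMap.sub_apply, ContinuousMap.sum_apply, ContinuousMap.sum_apply, Finset.sum_congr rfl (fun k _ => e1 (k+1))]

      rw [Finset.sum_comm]
      simp only [ContinuousMap.smul_apply, ContinuousMap.sub_apply, smul_eq_mul]
      rw [← Finset.sum_sub_distrib]
      apply Finset.sum_congr rfl
      intro n _
      rw [Finset.sum_range_succ', ← Finset.mul_sum, ← Finset.mul_sum]
      have e2 : exf (nu n) x = exf (mu0 n) x * Complex.exp (d n * x) := by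
        rw [exf_apply, exf_apply, ← Complex.exp_add]
        congr 1; rw [hd]; push_cast; ring
      rw [e2]; simp; ring
    rw [hval]
    refine (norm_sum_le _ _).trans ?_
    rw [hB, Finset.sum_mul]
    apply Finset.sum_le_sum
    intro n _
    rw [norm_mul, norm_mul, exf_norm, one_mul]
    gcongr
    apply exp_rem
    rw [norm_mul, Complex.norm_real]
    have : ‖x‖ ≤ 1 := abs_le.2 ⟨hx.1.le, hx.2.le⟩
    have := hdn n
    nlinarith [norm_nonneg (d n), norm_nonneg x]
  have hgeo : ∀ K : ℕ, ∑ k ∈ Finset.range K, (1/4:ℝ)^(k+1) ≤ 1/3 := by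
    intro K
    have : ∑ k ∈ Finset.range K, (1/4:ℝ)^(k+1) = 1/3 - 1/3 * (1/4)^K := by
      induction K with
      | zero => simp
      | succ K ih => rw [Finset.sum_range_succ, ih]; ring
    rw [this]
    have : (0:ℝ) ≤ (1/4)^K := by positivity
    linarith
  have hfin : ∀ K : ℕ, ‖LL h‖ ≤ B * (2 * (1/4)^(K+1)) * √2 + √2 / 3 * A := by
    intro K
    have e : LL h = LL (h - ∑ k ∈ Finset.range K, q (k+1)) + ∑ k ∈ Finset.range K, LL (q (k+1)) := by
      rw [map_sub, map_sum]; simp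
    rw [e]
    refine (norm_add_le _ _).trans (add_le_add (hrem K) ?_)
    refine (norm_sum_le _ _).trans ?_
    calc _ ≤ ∑ k ∈ Finset.range K, (1/4)^(k+1) * (√2 * A) := Finset.sum_le_sum fun k _ => hqn _
      _ = (∑ k ∈ Finset.range K, (1/4)^(k+1)) * (√2 * A) := by rw [Finset.sum_mul]
      _ ≤ 1/3 * (√2 * A) := by gcongr; exact hgeo K
      _ = _ := by ring
  have hlim : Tendsto (fun K : ℕ => B * (2 * (1/4)^(K+1)) * √2 + √2 / 3 * A) atTop
      (nhds (B * (2 * 0) * √2 + √2 / 3 * A)) := by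
    have : Tendsto (fun K : ℕ => (1/4:ℝ)^(K+1)) atTop (nhds 0) :=
      (tendsto_pow_atTop_nhds_zero_of_lt_one (by norm_num) (by norm_num)).comp (tendsto_add_atTop_nat 1)
    exact (((this.const_mul 2).const_mul B).mul_const _).add_const _
  have := ge_of_tendsto' hlim hfin
  simpa using this

lemma RB_perturb (nu : ℤ → ℝ) (hnu : ∀ n, |nu n - mu0 n| ≤ 1/4) : RB nu := by
  obtain ⟨T0, h0, hn⟩ := base_iso
  obtain ⟨K, hK, hKn⟩ := bessel_op (fun n => ev (nu n) - ev (mu0 n)) (√2/3) (by positivity)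
    (perturb_bound T0 h0 hn nu hnu)
  let N : HH →L[ℂ] HH := K.comp (T0.symm : HH →L[ℂ] l2Z)
  have hN : ‖-N‖ < 1 := by
    rw [norm_neg]
    refine lt_of_le_of_lt (N.opNorm_le_bound (M := 1/3) (by norm_num) ?_) (by norm_num)
    intro x
    have h1 := hKn (T0.symm x)
    have h2 := hn (T0.symm x)
    rw [ContinuousLinearEquiv.apply_symm_apply] at h2
    change ‖K (T0.symm x)‖ ≤ _
    rw [h2]; linarith
  let U : HH ≃L[ℂ] HH := ContinuousLinearEquiv.ofUnit (Units.oneSub (-N) hN)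
  refine ⟨T0.trans U, fun n => ?_⟩
  change ((Units.oneSub (-N) hN : (HH →L[ℂ] HH)ˣ) : HH →L[ℂ] HH) (T0 (lp.single 2 n (1:ℂ))) = _
  rw [Units.val_oneSub, sub_neg_eq_add]
  change T0 _ + K (T0.symm (T0 _)) = _
  rw [ContinuousLinearEquiv.symm_apply_apply, hK, h0]; simp

lemma inner_tail (c : ℂ) (hc : c ≠ 0) (t : ℝ) (ht : t ∈ Set.Ioo (-1:ℝ) 1) :
    ∫ x, (if t < x then Complex.exp (c * x) else 0) ∂μ11 = (Complex.exp c - Complex.exp (c * t)) / c := by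
  have h1 : (fun x : ℝ => if t < x then Complex.exp (c * x) else 0) =
      (Set.Ioi t).indicator (fun x : ℝ => Complex.exp (c * x)) := by
    ext x; simp [Set.indicator_apply]
  rw [h1, integral_indicator measurableSet_Ioi]
  have h2 : μ11.restrict (Set.Ioi t) = volume.restrict (Set.Ioo t 1) := by
    unfold μ11
    rw [Measure.restrict_restrict measurableSet_Ioi]
    congr 1
    ext x; simp only [Set.mem_inter_iff, Set.mem_Ioi, Set.mem_Ioo]
    constructor
    · rintro ⟨a, b, c⟩; exact ⟨a, c⟩
    · rintro ⟨a, b⟩; exact ⟨a, by linarith [ht.1], b⟩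
  rw [h2, ← integral_Ioc_eq_integral_Ioo, ← intervalIntegral.integral_of_le ht.2.le,
    integral_exp_mul_complex hc]
  simp

lemma prim_integrable (h : ℝ → ℂ) (hh : Integrable h μ11) (f : C(ℝ, ℂ)) :
    Integrable (fun p : ℝ × ℝ => if p.2 < p.1 then h p.2 * f p.1 else 0) (μ11.prod μ11) := by
  have hf : Integrable f μ11 := (memLp11 f).integrable (by norm_num)
  have h1 : Integrable (fun p : ℝ × ℝ => f p.1 * h p.2) (μ11.prod μ11) := hf.mul_prod hh
  have h2 := h1.indicator (measurableSet_lt measurable_snd measurable_fst)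
  refine h2.congr (ae_of_all _ fun p => ?_)
  simp only [Set.indicator_apply, Set.mem_ofPred_eq, mul_comm]

def prim (h : ℝ → ℂ) (x : ℝ) : ℂ := ∫ t, (if t < x then h t else 0) ∂μ11

lemma prim_memLp (h : ℝ → ℂ) (hh : Integrable h μ11) : MemLp (prim h) 2 μ11 := by
  refine MemLp.of_bound ?_ (∫ t, ‖h t‖ ∂μ11) (ae_of_all _ fun x => ?_)
  · have h1 := (prim_integrable h hh 1).integral_prod_left.aestronglyMeasurable
    refine h1.congr (ae_of_all _ fun x => ?_)
    simp [prim]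
  · refine (norm_integral_le_integral_norm _).trans ?_
    refine integral_mono_of_nonneg (ae_of_all _ fun _ => norm_nonneg _) hh.norm (ae_of_all _ fun t => ?_)
    simp only
    split_ifs
    · exact le_rfl
    · simp

lemma prim_integral (h : ℝ → ℂ) (hh : Integrable h μ11) (h0 : ∫ t, h t ∂μ11 = 0) (om : ℝ)
    (hom : om ≠ 0) :
    ∫ x, prim h x * exf om x ∂μ11 = Complex.I / om * ∫ t, h t * exf om t ∂μ11 := by
  have e1 : ∀ x, prim h x * exf om x = ∫ t, (if t < x then h t * exf om x else 0) ∂μ11 := by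
    intro x
    rw [prim, ← integral_mul_const]
    congr 1; ext t; split_ifs <;> simp
  simp only [e1]
  rw [integral_integral_swap (f := fun x t => if t < x then h t * exf om x else 0)
    (prim_integrable h hh (exf om))]
  have hc : Complex.I * (om : ℂ) ≠ 0 := by simp [hom]
  have e2 : ∫ t, ∫ x, (if t < x then h t * exf om x else 0) ∂μ11 ∂μ11 =
      ∫ t, (h t * (Complex.exp (Complex.I * om) / (Complex.I * om)) -
        (1 / (Complex.I * om)) * (h t * exf om t)) ∂μ11 := by
    apply integral_congr_ae
    filter_upwards [ae_mem11] with t ht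
    have := inner_tail _ hc t ht
    have e3 : (fun x : ℝ => (if t < x then h t * exf om x else 0)) =
      fun x : ℝ => h t * (if t < x then Complex.exp (Complex.I * om * x) else 0) := by
      ext x; rw [exf_apply]; split_ifs <;> simp
    rw [e3, integral_const_mul, this, exf_apply]
    ring
  have hi : Integrable (fun t => h t * exf om t) μ11 := by
    refine hh.mul_bdd (c := 1) (exf om).continuous.aestronglyMeasurable (ae_of_all _ fun x => ?_)
    exact (exf_norm om x).le
  rw [e2, integral_sub (hh.mul_const _) (hi.const_mul _), integral_mul_const, h0,
    integral_const_mul]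
  have : (1:ℂ) / (Complex.I * om) = - (Complex.I / om) := by
    have : (om : ℂ) ≠ 0 := by exact_mod_cast hom
    field_simp
    simp
  rw [this]; ring

lemma divide (ph : HH →L[ℂ] ℂ) (m : ℝ) (h0 : ph (ev m) = 0) :
    ∃ ps : HH →L[ℂ] ℂ, ∀ z : ℝ, z ≠ m → ps (ev z) = ph (ev z) / ((z : ℂ) - m) := by
  set w : HH := (InnerProductSpace.toDual ℂ HH).symm ph with hw
  have hph : ∀ f : C(ℝ, ℂ), ph (LL f) = ∫ x, star (w x) * f x ∂μ11 := by
    intro f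
    rw [← inner_LL, hw, InnerProductSpace.toDual_symm_apply]
  have hwi : Integrable (fun x => star (w x)) μ11 := by
    have h1 := L2.integrable_inner (𝕜 := ℂ) w (LL 1)
    refine h1.congr ?_
    filter_upwards [LL_coe 1] with x hx
    rw [hx]; simp
  set h : ℝ → ℂ := fun x => star (w x) * exf m x with hh
  have hhi : Integrable h μ11 := by
    refine hwi.mul_bdd (c := 1) (exf m).continuous.aestronglyMeasurable (ae_of_all _ fun x => ?_)
    exact (exf_norm m x).le
  have hh0 : ∫ t, h t ∂μ11 = 0 := by rw [← hph]; exact h0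
  have hkm : MemLp (fun x => star (exf (-m) x * prim h x)) 2 μ11 := by
    refine (prim_memLp h hhi).of_le ?_ (ae_of_all _ fun x => ?_)
    · have := ((exf (-m)).continuous.aestronglyMeasurable (μ := μ11)).mul
        (prim_memLp h hhi).aestronglyMeasurable
      exact this.star
    · rw [norm_star, norm_mul, exf_norm, one_mul]
  set kk : HH := hkm.toLp _ with hkk
  refine ⟨(-Complex.I) • innerSL ℂ kk, fun z hz => ?_⟩
  have hzm : ((z:ℂ) - m) ≠ 0 := by
    rw [sub_ne_zero]; exact_mod_cast hz
  have e1 : inner ℂ kk (ev z) = ∫ x, prim h x * exf (z - m) x ∂μ11 := by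
    rw [ev, inner_LL]
    apply integral_congr_ae
    filter_upwards [hkm.coeFn_toLp] with x hx
    rw [hx, star_star, exf_apply, exf_apply, exf_apply, mul_comm _ (prim h x), mul_assoc,
      ← Complex.exp_add]
    congr 2; push_cast; ring
  have e2 : ∫ t, h t * exf (z - m) t ∂μ11 = ph (ev z) := by
    rw [ev, hph]
    congr 1; ext x
    rw [hh]; simp only [exf_apply]
    rw [mul_assoc, ← Complex.exp_add]
    congr 2; push_cast; ring
  change (-Complex.I) * (inner ℂ kk (ev z)) = _
  rw [e1, prim_integral h hhi hh0 (z - m) (sub_ne_zero.2 hz), e2]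
  push_cast
  rw [show -Complex.I * (Complex.I / ((z:ℂ) - m) * ph (ev z)) =
    -(Complex.I * Complex.I) * (ph (ev z) / ((z:ℂ) - m)) by ring, Complex.I_mul_I]
  ring

lemma ev_continuous : Continuous ev := by
  have hL : LipschitzWith (Real.toNNReal √2) ev := by
    apply LipschitzWith.of_dist_le_mul
    intro a b
    rw [dist_eq_norm, dist_eq_norm, ev, ev, ← map_sub, Real.coe_toNNReal _ (by positivity), mul_comm,
      ← norm_ev 0]
    apply LL_norm_le
    intro x hx
    rw [exf_norm, mul_one, ContinuousMap.sub_apply]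
    have e : exf a x - exf b x = exf b x * (Complex.exp (Complex.I * ((a - b) * x : ℝ)) - 1) := by
      rw [exf_apply, exf_apply, mul_sub, ← Complex.exp_add, mul_one]
      congr 2; push_cast; ring
    rw [e, norm_mul, exf_norm, one_mul]
    refine (Real.norm_exp_I_mul_ofReal_sub_one_le).trans ?_
    rw [norm_mul]
    have : ‖x‖ ≤ 1 := abs_le.2 ⟨hx.1.le, hx.2.le⟩
    nlinarith [norm_nonneg (a - b)]
  exact hL.continuous

lemma coord_ne_zero (nu : ℤ → ℝ) (T : l2Z ≃L[ℂ] HH) (hT : ∀ n, T (lp.single 2 n (1:ℂ)) = ev (nu n))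
    (m : ℤ) (l : ℝ) (hne : ∀ n, n ≠ m → nu n ≠ l) : (T.symm (ev l)) m ≠ 0 := by
  intro h0
  set ph : HH →L[ℂ] ℂ := (lp.evalCLM ℂ (fun _ : ℤ => ℂ) 2 m).comp (T.symm : HH →L[ℂ] l2Z) with hph
  have hpa : ∀ f, ph f = (T.symm f) m := fun f => rfl
  have hpn : ∀ n, ph (ev (nu n)) = if n = m then 1 else 0 := by
    intro n
    rw [hpa, ← hT, ContinuousLinearEquiv.symm_apply_apply]
    split_ifs with h
    · subst h; simp
    · rw [lp.single_apply_ne _ _ _ (Ne.symm h)]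
  have hp1 : ph (ev (nu m)) = 1 := by rw [hpn]; simp
  have hlm : nu m ≠ l := by
    intro h
    rw [h, hpa, h0] at hp1
    exact zero_ne_one hp1
  obtain ⟨ps, hps⟩ := divide ph l h0
  set Ph : HH →L[ℂ] ℂ := ph + ((l:ℂ) - nu m) • ps with hPh
  have hval : ∀ z : ℝ, z ≠ l → Ph (ev z) = ph (ev z) * (((z:ℂ) - nu m) / ((z:ℂ) - l)) := by
    intro z hz
    have hz' : ((z:ℂ) - l) ≠ 0 := by rw [sub_ne_zero]; exact_mod_cast hz
    change ph (ev z) + ((l:ℂ) - nu m) * ps (ev z) = _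
    rw [hps z hz]
    field_simp
    ring
  have hPz : Ph.comp (T : l2Z →L[ℂ] HH) = 0 := by
    apply lp.ext_continuousLinearMap (by simp)
    intro n
    ext
    change Ph (T (lp.single 2 n (1:ℂ))) = 0
    rw [hT]
    by_cases hn : n = m
    · subst hn; rw [hval _ hlm]; simp
    · rw [hval _ (hne n hn), hpn, if_neg hn, zero_mul]
  have hP0 : ∀ f, Ph f = 0 := by
    intro f
    have := DFunLike.congr_fun hPz (T.symm f)
    change Ph (T (T.symm f)) = 0 at this
    rwa [ContinuousLinearEquiv.apply_symm_apply] at this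
  have hF : Continuous fun z : ℝ => ph (ev z) := ph.continuous.comp ev_continuous
  have hd : Dense (({l, nu m} : Set ℝ)ᶜ) := (Set.toFinite _).countable.dense_compl ℝ
  have hz : (fun z : ℝ => ph (ev z)) = fun _ => 0 := by
    refine hF.ext_on hd continuous_const ?_
    intro z hz
    simp only [Set.mem_compl_iff, Set.mem_insert_iff, Set.mem_singleton_iff, not_or] at hz
    have h1 := hval z hz.1
    rw [hP0] at h1
    have hz1 : ((z:ℂ) - l) ≠ 0 := by rw [sub_ne_zero]; exact_mod_cast hz.1
    have hz2 : ((z:ℂ) - nu m) ≠ 0 := by rw [sub_ne_zero]; exact_mod_cast hz.2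
    rcases mul_eq_zero.1 h1.symm with h | h
    · exact h
    · exact absurd h (div_ne_zero hz2 hz1)
  have := congr_fun hz (nu m)
  simp only [hp1] at this
  exact one_ne_zero this

lemma RB_exchange (nu : ℤ → ℝ) (hRB : RB nu) (m : ℤ) (l : ℝ) (hne : ∀ n, n ≠ m → nu n ≠ l) :
    RB (Function.update nu m l) := by
  obtain ⟨T, hT⟩ := hRB
  have hk := coord_ne_zero nu T hT m l hne
  set c : l2Z := T.symm (ev l) with hc
  set k : ℂ := c m with hkdef
  set e : l2Z := lp.single 2 m (1:ℂ) with he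
  have hem : e m = 1 := by rw [he]; simp
  let co : l2Z →L[ℂ] ℂ := lp.evalCLM ℂ (fun _ : ℤ => ℂ) 2 m
  have hco : ∀ a, co a = a m := fun a => rfl
  have hcom : co (c - e) = k - 1 := by
    rw [map_sub, hco, hco, hem]
  let E1 : l2Z →L[ℂ] l2Z := ContinuousLinearMap.id ℂ l2Z + co.smulRight (c - e)
  let E2 : l2Z →L[ℂ] l2Z := ContinuousLinearMap.id ℂ l2Z - (k⁻¹ • co).smulRight (c - e)
  have hE1 : ∀ a, E1 a = a + co a • (c - e) := fun a => rfl
  have hE2 : ∀ a, E2 a = a - (k⁻¹ * co a) • (c - e) := fun a => rfl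
  let E : l2Z ≃L[ℂ] l2Z := ContinuousLinearEquiv.equivOfInverse E1 E2
    (by
      intro a
      rw [hE2, hE1, map_add, map_smul, hcom, add_sub_assoc, ← sub_smul, smul_eq_mul]
      rw [show co a - k⁻¹ * (co a + co a * (k - 1)) = 0 by field_simp; ring]
      simp)
    (by
      intro a
      rw [hE1, hE2, map_sub, map_smul, hcom, sub_add, ← sub_smul, smul_eq_mul]
      rw [show k⁻¹ * co a - (co a - k⁻¹ * co a * (k - 1)) = 0 by field_simp; ring]
      simp)
  refine ⟨E.trans T, fun n => ?_⟩
  change T (E1 (lp.single 2 n (1:ℂ))) = _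
  rw [hE1, hco]
  by_cases hn : n = m
  · subst hn
    rw [← he, hem, one_smul, add_sub_cancel, hc, ContinuousLinearEquiv.apply_symm_apply,
      Function.update_self]
  · rw [lp.single_apply_ne _ _ _ (Ne.symm hn), zero_smul, add_zero, hT, Function.update_of_ne hn]

lemma fc_tendsto (g : ℝ → ℂ) : Tendsto (fun n : ℤ => fc g n) cofinite (nhds 0) := by
  have h1 := (Real.tendsto_integral_exp_smul_cocompact
    ((Set.Ioc (0:ℝ) 1).indicator g)).comp Int.tendsto_coe_cofinite
  refine h1.congr fun n => ?_
  rw [fc, intervalIntegral.integral_of_le zero_le_one, ← integral_indicator measurableSet_Ioc]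
  simp only [Function.comp]
  congr 1; ext x
  by_cases hx : x ∈ Set.Ioc (0:ℝ) 1
  · rw [Set.indicator_of_mem hx, Set.indicator_of_mem hx, Circle.smul_def, Real.fourierChar_apply,
      smul_eq_mul]
    congr 2; push_cast; ring
  · rw [Set.indicator_of_notMem hx, Set.indicator_of_notMem hx, smul_zero]

lemma RB_main (lam : ℤ → ℝ) (hmono : StrictMono lam)
    (hlim : Tendsto (fun n => lam n - mu0 n) cofinite (nhds 0)) : RB lam := by
  have hfin : {n : ℤ | ¬ |lam n - mu0 n| ≤ 1/4}.Finite := by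
    have h1 : ∀ᶠ n in cofinite, |lam n - mu0 n| ≤ 1/4 := by
      filter_upwards [hlim.abs.eventually_lt_const (show |(0:ℝ)| < 1/4 by norm_num)] with n hn
        using hn.le
    exact h1
  have hcount : (Set.range fun q : ℤ × ℤ => lam q.1 - mu0 q.2).Countable := Set.countable_range _
  obtain ⟨δ, hδ, hδ1⟩ := (hcount.dense_compl ℝ).exists_mem_open isOpen_Ioo
    (⟨1/8, by norm_num, by norm_num⟩ : (Set.Ioo (0:ℝ) (1/4)).Nonempty)
  have hδn : ∀ k n, mu0 n + δ ≠ lam k := by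
    intro k n h
    exact hδ ⟨(k, n), by simp only; linarith⟩
  set base : ℤ → ℝ := fun n => if |lam n - mu0 n| ≤ 1/4 then lam n else mu0 n + δ with hbase
  have hb0 : RB base := by
    apply RB_perturb
    intro n
    rw [hbase]; simp only
    split_ifs with h
    · exact h
    · rw [add_sub_cancel_left, abs_of_pos hδ1.1]; exact hδ1.2.le
  have hbne : ∀ n m, n ≠ m → base n ≠ lam m := by
    intro n m hnm
    rw [hbase]; simp only
    split_ifs with h
    · exact fun h => hnm (hmono.injective h)
    · exact hδn m n
  have hind : ∀ s : Finset ℤ, RB (fun n => if n ∈ s then lam n else base n) := by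
    intro s
    induction s using Finset.induction_on with
    | empty => simpa using hb0
    | insert m s hm ih =>
      have h1 := RB_exchange _ ih m (lam m) (by
        intro n hn
        split_ifs
        · exact fun h => hn (hmono.injective h)
        · exact hbne n m hn)
      convert h1 using 1
      ext n
      by_cases hn : n = m
      · subst hn; simp
      · rw [Function.update_of_ne hn]; simp [hn]
  have h2 := hind hfin.toFinset
  convert h2 using 1
  ext n
  by_cases hn : |lam n - mu0 n| ≤ 1/4
  · have hb : base n = lam n := by rw [hbase]; exact if_pos hn
    rw [hb, ite_self]
  · rw [if_pos]
    rw [Set.Finite.mem_toFinset]; exact hn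

/-- The system `(e^{iλ_n x})_{n∈ℤ}` is a Riesz basis of `L₂(-1,1)`. -/
theorem statement11 (p : ℝ≥0∞) (hp : 1 ≤ p) (hp' : p ≠ ∞)
    (lam : ℤ → ℝ) (hmono : StrictMono lam) (hla : LamAsymp p lam) :
    ∃ T : lp (fun _ : ℤ => ℂ) 2 ≃L[ℂ] Lp ℂ 2 μ11,
      ∀ a : lp (fun _ : ℤ => ℂ) 2,
        Tendsto (fun N : ℕ =>
          eLpNorm (fun x : ℝ =>
            (∑ n ∈ Finset.Icc (-(N:ℤ)) (N:ℤ),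
              a n * Complex.exp (Complex.I * (lam n : ℂ) * (x : ℂ))) - T a x) 2 μ11)
          atTop (nhds 0) := by
  obtain ⟨g, -, hg⟩ := hla
  have hlim : Tendsto (fun n => lam n - mu0 n) cofinite (nhds 0) := by
    have h1 := (Complex.continuous_re.tendsto 0).comp (fc_tendsto g)
    rw [Complex.zero_re] at h1
    refine h1.congr fun n => ?_
    have h2 : fc g n = ((lam n - mu0 n : ℝ) : ℂ) := by
      rw [mu0]; push_cast; rw [hg n]; ring
    rw [Function.comp, h2, Complex.ofReal_re]
  obtain ⟨T, hT⟩ := RB_main lam hmono hlim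
  refine ⟨T, fun a => ?_⟩
  have hs : HasSum (fun n => a n • ev (lam n)) (T a) := by
    have h1 : HasSum (fun n => (lp.single 2 n (a n) : l2Z)) a := lp.hasSum_single (by simp) a
    have h2 := h1.mapL (T : l2Z →L[ℂ] HH)
    have e : (fun n => a n • ev (lam n)) = fun n => (T : l2Z →L[ℂ] HH) (lp.single 2 n (a n)) := by
      ext1 n
      change _ = T (lp.single 2 n (a n))
      rw [← hT, ← map_smul, ← lp.single_smul]; simp
    rw [e]; exact h2
  have ht : Tendsto (fun N : ℕ => ∑ n ∈ Finset.Icc (-(N:ℤ)) (N:ℤ), a n • ev (lam n)) atTop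
      (nhds (T a)) := hs.comp Finset.tendsto_Icc_neg
  have ht2 := (ENNReal.continuous_ofReal.tendsto 0).comp (tendsto_iff_norm_sub_tendsto_zero.1 ht)
  rw [ENNReal.ofReal_zero] at ht2
  refine ht2.congr fun N => ?_
  have e1 : ∑ n ∈ Finset.Icc (-(N:ℤ)) (N:ℤ), a n • ev (lam n) =
      LL (∑ n ∈ Finset.Icc (-(N:ℤ)) (N:ℤ), a n • exf (lam n)) := by
    simp only [map_sum, map_smul]; rfl
  simp only [Function.comp]
  rw [e1, Lp.norm_def, ENNReal.ofReal_toReal (Lp.eLpNorm_ne_top _)]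
  apply eLpNorm_congr_ae
  filter_upwards [Lp.coeFn_sub (LL (∑ n ∈ Finset.Icc (-(N:ℤ)) (N:ℤ), a n • exf (lam n))) (T a),
    LL_coe (∑ n ∈ Finset.Icc (-(N:ℤ)) (N:ℤ), a n • exf (lam n))] with x h1 h2
  rw [h1, Pi.sub_apply, h2, ContinuousMap.sum_apply]
  rfl
end
end
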